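/- arXiv:1004.3603 — 3 statements merged into one kernel-verified Lean document; each statement's English description precedes it below -/
import Mathlib

section
/- Let F be a field of characteristic different from 2 and let M be an invertible n×n matrix over F. Then M ∉ Ξ_n(F) if and only if M^{-T}M has a direct summand for similarity of the form J_r(1) with r odd. -/
open Matrix Polynomial

variable {F : Type*} [Field F]

/-- `M ∈ Ξ_n(F)`: every invertible `S` with `SᵀMS = M` has `det S = 1`. -/
def XiMem {n : ℕ} (M : Matrix (Fin n) (Fin n) F) : Prop :=
  ∀ S : Matrix (Fin n) (Fin n) F, IsUnit S → Sᵀ * M * S = M → S.det = 1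

/-- Congruence of square matrices: `SᵀAS = B` for some invertible `S`. -/
def MatCongruent {n : ℕ} (A B : Matrix (Fin n) (Fin n) F) : Prop :=
  ∃ S : Matrix (Fin n) (Fin n) F, IsUnit S ∧ Sᵀ * A * S = B

/-- Similarity of square matrices: `S⁻¹AS = B` for some invertible `S`. -/
def MatSimilar {n : ℕ} (A B : Matrix (Fin n) (Fin n) F) : Prop :=
  ∃ S : Matrix (Fin n) (Fin n) F, IsUnit S ∧ S⁻¹ * A * S = B

/-- Block-diagonal direct sum `A ⊕ B`. -/
def dSum {a b : ℕ} (A : Matrix (Fin a) (Fin a) F) (B : Matrix (Fin b) (Fin b) F) :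
    Matrix (Fin (a + b)) (Fin (a + b)) F :=
  Matrix.reindex finSumFinEquiv finSumFinEquiv (Matrix.fromBlocks A 0 0 B)

/-- Skew sum `[A ╲ B] = [[0, B], [A, 0]]` of two `m × m` matrices. -/
def skewSum {m : ℕ} (A B : Matrix (Fin m) (Fin m) F) :
    Matrix (Fin (m + m)) (Fin (m + m)) F :=
  Matrix.reindex finSumFinEquiv finSumFinEquiv (Matrix.fromBlocks 0 B A 0)

/-- `A` is a direct summand of `M` for congruence. -/
def CongSummand {n r : ℕ} (M : Matrix (Fin n) (Fin n) F)
    (A : Matrix (Fin r) (Fin r) F) : Prop :=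
  ∃ (s : ℕ) (h : r + s = n) (B : Matrix (Fin s) (Fin s) F),
    MatCongruent M (Matrix.reindex (finCongr h) (finCongr h) (dSum A B))

/-- `A` is a direct summand of `M` for similarity. -/
def SimSummand {n r : ℕ} (M : Matrix (Fin n) (Fin n) F)
    (A : Matrix (Fin r) (Fin r) F) : Prop :=
  ∃ (s : ℕ) (h : r + s = n) (B : Matrix (Fin s) (Fin s) F),
    MatSimilar M (Matrix.reindex (finCongr h) (finCongr h) (dSum A B))

/-- `(A, B)` is a direct summand of the pair `(M, N)` for equivalence:
`(M, N)` is equivalent to `(A, B) ⊕ (C, D)` for some pair `(C, D)`. -/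
def PairSummand {n a b : ℕ} (M N : Matrix (Fin n) (Fin n) F)
    (A B : Matrix (Fin a) (Fin b) F) : Prop :=
  ∃ (c d : ℕ) (hc : a + c = n) (hd : b + d = n)
    (C D : Matrix (Fin c) (Fin d) F)
    (R S : Matrix (Fin n) (Fin n) F), IsUnit R ∧ IsUnit S ∧
      R * M * S = Matrix.reindex (finSumFinEquiv.trans (finCongr hc))
          (finSumFinEquiv.trans (finCongr hd)) (Matrix.fromBlocks A 0 0 C) ∧
      R * N * S = Matrix.reindex (finSumFinEquiv.trans (finCongr hc))
          (finSumFinEquiv.trans (finCongr hd)) (Matrix.fromBlocks B 0 0 D)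

/-- The `r × r` Jordan block `J_r(λ)`: `λ` on the diagonal, `1` on the subdiagonal. -/
def jordanBlock (r : ℕ) (lam : F) : Matrix (Fin r) (Fin r) F :=
  Matrix.of fun i j =>
    if (i : ℕ) = (j : ℕ) then lam else if (i : ℕ) = (j : ℕ) + 1 then 1 else 0

/-- The matrix `Γ_r`: with 1-based indices, entry `(i, j)` is `(-1)^(r - i)` if
`i + j = r + 1` or `i + j = r + 2`, and `0` otherwise. -/
def Gam (r : ℕ) : Matrix (Fin r) (Fin r) F :=
  Matrix.of fun i j =>
    if (i : ℕ) + (j : ℕ) = r - 1 ∨ (i : ℕ) + (j : ℕ) = r then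
      (-1 : F) ^ (r - 1 - (i : ℕ)) else 0

/-- Companion matrix of a monic polynomial `x^m + c₁x^(m-1) + ⋯ + c_m`:
`1`'s on the subdiagonal, last column `(-c_m, …, -c₂, -c₁)ᵀ`. -/
def companion (q : Polynomial F) : Matrix (Fin q.natDegree) (Fin q.natDegree) F :=
  Matrix.of fun i j =>
    if (j : ℕ) = q.natDegree - 1 then -q.coeff (i : ℕ)
    else if (i : ℕ) = (j : ℕ) + 1 then 1 else 0

/-- A Frobenius block: the companion matrix of `p^l` with `p` monic irreducible, `l ≥ 1`. -/
def IsFrobeniusBlock {m : ℕ} (A : Matrix (Fin m) (Fin m) F) : Prop :=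
  ∃ (p : Polynomial F) (l : ℕ), p.Monic ∧ Irreducible p ∧ 1 ≤ l ∧
    ∃ h : (p ^ l).natDegree = m,
      A = Matrix.reindex (finCongr h) (finCongr h) (companion (p ^ l))

/-- `Φ` is a cosquare: `Φ = A⁻ᵀA` for some invertible `A`. -/
def IsCosquare {m : ℕ} (A : Matrix (Fin m) (Fin m) F) : Prop :=
  ∃ Q : Matrix (Fin m) (Fin m) F, IsUnit Q ∧ Q⁻¹ᵀ * Q = A

/-- The `(t-1) × t` matrix `F_t` with `F_t(i, j) = 1` iff `j = i`. -/
def Fmat (t : ℕ) : Matrix (Fin (t - 1)) (Fin t) F :=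
  Matrix.of fun i j => if (j : ℕ) = (i : ℕ) then 1 else 0

/-- The `(t-1) × t` matrix `G_t` with `G_t(i, j) = 1` iff `j = i + 1`. -/
def Gmat (t : ℕ) : Matrix (Fin (t - 1)) (Fin t) F :=
  Matrix.of fun i j => if (j : ℕ) = (i : ℕ) + 1 then 1 else 0

theorem det_eq_one_of_isAlt_of_ker_one_add_eq_bot {F V : Type*} [Field F] [AddCommGroup V] [Module F V]
    [FiniteDimensional F V] (ω : V →ₗ[F] V →ₗ[F] F) (hω : LinearMap.ker ω = ⊥)
    (S : Module.End F V) (hS : ∀ x y, ω (S x) (S y) = ω x y)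
    (hker : LinearMap.ker (1 + S) = ⊥) : LinearMap.det S = 1 := by
  let e : V ≃ₗ[F] Module.Dual F V :=
    LinearEquiv.ofInjectiveOfFinrankEq ω (LinearMap.ker_eq_bot.mp hω) Subspace.dual_finrank_eq.symm
  have he : ∀ x, e x = ω x := fun x => rfl
  have he' : ∀ x, e.symm (ω x) = x := e.symm_apply_apply
  have key : S.dualMap ∘ₗ (e.toLinearMap ∘ₗ (1 + S) ∘ₗ e.symm.toLinearMap) = (1 + S).dualMap := by
    ext f y
    obtain ⟨x, rfl⟩ := e.surjective f
    simp [he, he', hS, add_comm]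
  have hdet := congrArg LinearMap.det key
  rw [LinearMap.det_comp, LinearMap.det_conj, LinearMap.det_dualMap, LinearMap.det_dualMap] at hdet
  have h0 : LinearMap.det (1 + S) ≠ 0 := by
    intro h
    exact (LinearMap.bot_lt_ker_of_det_eq_zero h).ne' hker
  exact mul_right_cancel₀ h0 (by rw [hdet, one_mul])

theorem det_eq_one_of_isAlt {F V : Type*} [Field F] [AddCommGroup V] [Module F V]
    [FiniteDimensional F V] (ω : V →ₗ[F] V →ₗ[F] F) (halt : ω.IsAlt)
    (hω : LinearMap.ker ω = ⊥)
    (S : Module.End F V) (hS : ∀ x y, ω (S x) (S y) = ω x y) : LinearMap.det S = 1 := by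
  induction hd : Module.finrank F (LinearMap.ker (1 + S)) using Nat.strong_induction_on
    generalizing S with
  | _ d ih =>
  by_cases hker : LinearMap.ker (1 + S) = ⊥
  · exact det_eq_one_of_isAlt_of_ker_one_add_eq_bot ω hω S hS hker
  obtain ⟨v, hv, hv0⟩ := Submodule.exists_mem_ne_zero_of_ne_bot hker
  have hSv : S v = -v := by
    have : v + S v = 0 := hv
    exact (neg_eq_of_add_eq_zero_right this).symm
  obtain ⟨u, hu⟩ : ∃ u, ω u v ≠ 0 := by
    by_contra! h
    refine hv0 (LinearMap.ker_eq_bot'.mp hω v ?_)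
    ext u
    rw [← halt.neg, h, neg_zero, LinearMap.zero_apply]
  set T : Module.End F V := LinearMap.transvection (ω u) u with hT
  have hTx : ∀ x, T x = x + ω u x • u := fun x => by simp [hT, LinearMap.transvection.apply]
  have hSx : ∀ x, ω (S x) v = -ω x v := fun x => by
    have := hS x v
    rw [hSv, map_neg] at this
    rw [← this, neg_neg]
  have hmem : ∀ x, x ∈ LinearMap.ker (1 + S * T) → ω u x = 0 ∧ x + S x = 0 := by
    intro x hx
    have hx' : x + (S x + ω u x • S u) = 0 := by
      have : x + S (T x) = 0 := hx
      rwa [hTx, map_add, map_smul] at this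
    have h1 : ω u x = 0 := by
      have h2 := congrArg (fun z => ω z v) hx'
      simp only [map_add, map_smul, LinearMap.add_apply, LinearMap.smul_apply, hSx, map_zero,
        LinearMap.zero_apply, smul_eq_mul] at h2
      have h3 : ω u x * ω u v = 0 := by linear_combination -h2
      exact (mul_eq_zero.mp h3).resolve_right hu
    exact ⟨h1, by simpa [h1] using hx'⟩
  have hlt : LinearMap.ker (1 + S * T) < LinearMap.ker (1 + S) := by
    refine lt_of_le_of_ne (fun x hx => (hmem x hx).2) fun h => ?_
    exact hu (hmem v (h ▸ hv)).1
  have hdetT : LinearMap.det T = 1 := by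
    rw [hT, LinearMap.transvection.det, halt u, add_zero]
  have := ih _ (hd ▸ Submodule.finrank_lt_finrank_of_lt hlt) (S * T) (fun x y => by
    rw [Module.End.mul_apply, Module.End.mul_apply, hS, hTx, hTx]
    have h1 := halt u
    have h2 := halt.neg u x
    simp only [map_add, map_smul, LinearMap.add_apply, LinearMap.smul_apply, smul_eq_mul, h1]
    rw [← h2]; ring) rfl
  rwa [map_mul, hdetT, mul_one] at this

theorem det_eq_det_of_range_eq_ker {F V K : Type*} [Field F] [AddCommGroup V] [Module F V]
    [FiniteDimensional F V] [AddCommGroup K] [Module F K]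
    (ω : V →ₗ[F] V →ₗ[F] F) (halt : ω.IsAlt)
    (S : Module.End F V) (hS : ∀ x y, ω (S x) (S y) = ω x y)
    (i : K →ₗ[F] V) (hi : Function.Injective i) (hr : LinearMap.range i = LinearMap.ker ω)
    (SK : Module.End F K) (hSK : ∀ x, i (SK x) = S (i x)) :
    LinearMap.det S = LinearMap.det SK := by
  have hmem : ∀ x, i x ∈ LinearMap.ker ω := fun x => hr ▸ LinearMap.mem_range_self i x
  have hker : LinearMap.ker ω ≤ (LinearMap.ker ω).comap S := by
    intro x hx
    rw [← hr] at hx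
    obtain ⟨y, rfl⟩ := hx
    rw [Submodule.mem_comap, ← hSK]
    exact hmem _
  have hker' : ∀ y ∈ LinearMap.ker ω, ∀ x, ω x y = 0 := fun y hy x => by
    rw [← halt.neg, LinearMap.mem_ker.mp hy, LinearMap.zero_apply, neg_zero]
  rw [LinearMap.det_eq_det_mul_det (LinearMap.ker ω) S hker]
  let e : K ≃ₗ[F] LinearMap.ker ω :=
    (LinearEquiv.ofInjective i hi).trans (LinearEquiv.ofEq _ _ hr)
  have he : ∀ x, (e x : V) = i x := fun x => rfl
  have h1 : S.restrict hker = e.toLinearMap ∘ₗ SK ∘ₗ e.symm.toLinearMap := by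
    ext x
    obtain ⟨y, rfl⟩ := e.surjective x
    simp [he, hSK]
  let ω' : (V ⧸ LinearMap.ker ω) →ₗ[F] (V ⧸ LinearMap.ker ω) →ₗ[F] F :=
    (LinearMap.ker ω).liftQ
      (LinearMap.flip ((LinearMap.ker ω).liftQ ω.flip (fun y hy => by
        ext x
        exact hker' y hy x))) (fun x hx => by
        ext y
        exact congrArg (fun f => f y) (LinearMap.mem_ker.mp hx))
  have hω' : ∀ x y, ω' (Submodule.Quotient.mk x) (Submodule.Quotient.mk y) = ω x y :=
    fun x y => rfl
  have h2 : LinearMap.det ((LinearMap.ker ω).mapQ (LinearMap.ker ω) S hker) = 1 := by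
    refine det_eq_one_of_isAlt ω' ?_ ?_ _ ?_
    · intro x
      induction x using Submodule.Quotient.induction_on with
      | _ x => exact halt x
    · refine LinearMap.ker_eq_bot'.mpr fun x hx => ?_
      induction x using Submodule.Quotient.induction_on with
      | _ x =>
        rw [Submodule.Quotient.mk_eq_zero, LinearMap.mem_ker]
        ext y
        rw [← hω', hx, LinearMap.zero_apply, LinearMap.zero_apply]
    · intro x y
      induction x using Submodule.Quotient.induction_on with
      | _ x =>
      induction y using Submodule.Quotient.induction_on with
      | _ y => exact hS x y
  rw [h1, h2, LinearMap.det_conj, mul_one]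

theorem det_restrict_congr {F V : Type*} [Field F] [AddCommGroup V] [Module F V]
    {S : Module.End F V} {p q : Submodule F V} (h : p = q) (hp : ∀ x ∈ p, S x ∈ p)
    (hq : ∀ x ∈ q, S x ∈ q) :
    LinearMap.det (S.restrict hp) = LinearMap.det (S.restrict hq) := by
  subst h
  rfl

/-- `σ` is the asymmetry of the bilinear form `B`, with inverse `τ`. -/
structure IsAsymmetry {F V : Type*} [Field F] [AddCommGroup V] [Module F V]
    (B : V →ₗ[F] V →ₗ[F] F) (σ τ : Module.End F V) : Prop where
  ker_eq_bot : LinearMap.ker B = ⊥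
  mul_inv : σ * τ = 1
  inv_mul : τ * σ = 1
  apply_comm : ∀ x y, B x y = B (σ y) x

namespace IsAsymmetry

variable {F V : Type*} [Field F] [AddCommGroup V] [Module F V]
  {B : V →ₗ[F] V →ₗ[F] F} {σ τ : Module.End F V}

theorem eq_of_left (h : IsAsymmetry B σ τ) {x y : V} (hxy : ∀ z, B x z = B y z) : x = y :=
  LinearMap.ker_eq_bot.mp h.ker_eq_bot (LinearMap.ext hxy)

theorem apply_inv (h : IsAsymmetry B σ τ) (x : V) : σ (τ x) = x :=
  congrArg (fun f : Module.End F V => f x) h.mul_inv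

theorem inv_apply (h : IsAsymmetry B σ τ) (x : V) : τ (σ x) = x :=
  congrArg (fun f : Module.End F V => f x) h.inv_mul

theorem apply_sub_one_pow (h : IsAsymmetry B σ τ) (m : ℕ) (x y : V) :
    B (((σ - 1) ^ m) x) y = B x (((τ - 1) ^ m) y) := by
  induction m generalizing x with
  | zero => rfl
  | succ m ih =>
    have h1 : ∀ z w, B ((σ - 1) z) w = B z ((τ - 1) w) := fun z w => by
      have : B (σ z) w = B z (τ w) := by
        rw [h.apply_comm z, h.apply_inv, h.apply_comm w]
      simp [this]
    rw [pow_succ, Module.End.mul_apply, ih, h1, pow_succ', Module.End.mul_apply]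

theorem commute_sub_one_neg_inv (h : IsAsymmetry B σ τ) : Commute (σ - 1) (-τ) := by
    have : Commute σ τ := h.mul_inv.trans h.inv_mul.symm
    exact (this.sub_left (Commute.one_left τ)).neg_right

theorem inv_sub_one_pow (h : IsAsymmetry B σ τ) (m : ℕ) :
    (τ - 1) ^ m = (σ - 1) ^ m * (-τ) ^ m := by
  have h1 : τ - 1 = (σ - 1) * (-τ) := by
    rw [mul_neg, sub_mul, h.mul_inv, one_mul, neg_sub]
  have h2 := h.commute_sub_one_neg_inv
  rw [h1, h2.mul_pow]

theorem inv_sub_one_pow_apply (h : IsAsymmetry B σ τ) (m : ℕ) {y : V}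
    (hy : ((σ - 1) ^ (m + 1)) y = 0) :
    ((τ - 1) ^ m) y = (-1) ^ m • ((σ - 1) ^ m) y := by
  have hfix : τ (((σ - 1) ^ m) y) = ((σ - 1) ^ m) y := by
    rw [pow_succ', Module.End.mul_apply, LinearMap.sub_apply, Module.End.one_apply,
      sub_eq_zero] at hy
    conv_lhs => rw [← hy]
    exact h.inv_apply _
  have h2 := h.commute_sub_one_neg_inv
  rw [h.inv_sub_one_pow, (h2.pow_pow m m).eq, Module.End.mul_apply]
  have : ∀ j : ℕ, ((-τ) ^ j) (((σ - 1) ^ m) y) = (-1) ^ j • ((σ - 1) ^ m) y := by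
    intro j
    induction j with
    | zero => simp
    | succ j ih =>
      rw [pow_succ', Module.End.mul_apply, ih, map_zsmul, LinearMap.neg_apply, hfix, pow_succ]
      simp
  exact this m

/-- The forms `(x, y) ↦ B x ((σ - 1) ^ k y)` are alternately symmetric and skew-symmetric on
`ker (σ - 1) ^ (k + 1)`. -/
theorem apply_pow_comm (h : IsAsymmetry B σ τ) (k : ℕ) {x y : V}
    (hx : ((σ - 1) ^ (k + 1)) x = 0) (hy : ((σ - 1) ^ (k + 1)) y = 0) :
    B y (((σ - 1) ^ k) x) = (-1) ^ k * B x (((σ - 1) ^ k) y) := by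
  have hfix : σ (((σ - 1) ^ k) x) = ((σ - 1) ^ k) x := by
    rwa [pow_succ', Module.End.mul_apply, LinearMap.sub_apply, Module.End.one_apply,
      sub_eq_zero] at hx
  rw [h.apply_comm, hfix, h.apply_sub_one_pow, h.inv_sub_one_pow_apply k hy, map_zsmul]
  simp

theorem apply_pow_eq_zero (h : IsAsymmetry B σ τ) (m : ℕ) {x : V} (hx : ((σ - 1) ^ m) x = 0)
    (w : V) : B x (((σ - 1) ^ m) w) = 0 := by
  have h1 := h.commute_sub_one_neg_inv
  have h2 : Commute σ (σ - 1) := (Commute.refl σ).sub_right (Commute.one_right σ)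
  rw [h.apply_comm, ← Module.End.mul_apply, (h2.pow_right m).eq, Module.End.mul_apply,
    h.apply_sub_one_pow, h.inv_sub_one_pow, (h1.pow_pow m m).eq, Module.End.mul_apply, hx,
    map_zero, map_zero]

theorem mem_range_pow [FiniteDimensional F V] (h : IsAsymmetry B σ τ) (m : ℕ) {v : V}
    (hv : ∀ x, ((σ - 1) ^ m) x = 0 → B x v = 0) : v ∈ LinearMap.range ((σ - 1) ^ m) := by
  have h1 : B.flip v ∈ (LinearMap.ker ((σ - 1) ^ m)).dualAnnihilator := by
    rw [Submodule.mem_dualAnnihilator]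
    exact fun x hx => hv x hx
  rw [← LinearMap.range_dualMap_eq_dualAnnihilator_ker] at h1
  obtain ⟨f, hf⟩ := h1
  have hsurj : Function.Surjective B.flip := by
    rw [← LinearMap.injective_iff_surjective_of_finrank_eq_finrank
      Subspace.dual_finrank_eq.symm, ← LinearMap.ker_eq_bot, LinearMap.ker_eq_bot']
    intro y hy
    have : σ y = 0 := h.eq_of_left fun z => by
      rw [← h.apply_comm, map_zero, LinearMap.zero_apply]
      exact congrArg (fun f => f z) hy
    rw [← h.inv_apply y, this, map_zero]
  obtain ⟨w, rfl⟩ := hsurj f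
  have h2 : ∀ x, B x v = B x (((τ - 1) ^ m) w) := fun x => by
    rw [← h.apply_sub_one_pow]
    exact (congrArg (fun f => f x) hf).symm
  have h3 : v = ((τ - 1) ^ m) w := by
    have h4 : σ v = σ (((τ - 1) ^ m) w) := h.eq_of_left fun z => by
      rw [← h.apply_comm, ← h.apply_comm, h2]
    rw [← h.inv_apply v, h4, h.inv_apply]
  rw [h3, h.inv_sub_one_pow, Module.End.mul_apply]
  exact LinearMap.mem_range_self _ _

section Isometry

variable {S : Module.End F V}

theorem commute_of_isometry (h : IsAsymmetry B σ τ) (hS : ∀ x y, B (S x) (S y) = B x y)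
    (hsurj : Function.Surjective S) : Commute S σ := by
  ext y
  refine h.eq_of_left fun z => ?_
  obtain ⟨x, rfl⟩ := hsurj z
  rw [Module.End.mul_apply, Module.End.mul_apply, hS, ← h.apply_comm, ← h.apply_comm, hS]

/-- The socle layers `ker (σ - 1) ⊓ range (σ - 1) ^ k`. -/
def socle (σ : Module.End F V) (k : ℕ) : Submodule F V :=
  LinearMap.ker (σ - 1) ⊓ LinearMap.range ((σ - 1) ^ k)

theorem socle_succ_le (σ : Module.End F V) (k : ℕ) : socle σ (k + 1) ≤ socle σ k := by
  refine inf_le_inf_left _ ?_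
  rw [pow_succ]
  exact LinearMap.range_comp_le_range _ _

theorem map_mem_socle {σ : Module.End F V} (hc : Commute S σ) (k : ℕ) :
    ∀ x ∈ socle σ k, S x ∈ socle σ k := by
  have hN : Commute S (σ - 1) := hc.sub_right (Commute.one_right S)
  rintro _ ⟨hx, w, rfl⟩
  refine ⟨?_, S w, ?_⟩
  · change (σ - 1) (S _) = 0
    rw [← Module.End.mul_apply, ← hN.eq, Module.End.mul_apply, LinearMap.mem_ker.mp hx, map_zero]
  · rw [← Module.End.mul_apply, ← (hN.pow_right k).eq, Module.End.mul_apply]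

theorem socle_eq_of_even [FiniteDimensional F V] (hchar : (2 : F) ≠ 0) (h : IsAsymmetry B σ τ)
    {k : ℕ} (hk : Even k)
    (hz : ∀ x, ((σ - 1) ^ (k + 1)) x = 0 → B x (((σ - 1) ^ k) x) = 0) :
    socle σ k = socle σ (k + 1) := by
  refine le_antisymm ?_ (socle_succ_le σ k)
  rintro _ ⟨hx, w, rfl⟩
  refine ⟨hx, h.mem_range_pow _ fun x hx0 => ?_⟩
  have hw : ((σ - 1) ^ (k + 1)) w = 0 := by rwa [pow_succ']
  have h1 := hz (x + w) (by rw [map_add, hx0, hw, add_zero])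
  have h2 := h.apply_pow_comm k hx0 hw
  rw [hk.neg_one_pow, one_mul] at h2
  simp only [map_add, LinearMap.add_apply, hz x hx0, hz w hw, h2] at h1
  have h3 : (2 : F) * B x (((σ - 1) ^ k) w) = 0 := by linear_combination h1
  exact (mul_eq_zero.mp h3).resolve_left hchar

theorem det_restrict_socle_of_odd [FiniteDimensional F V] (hchar : (2 : F) ≠ 0)
    (h : IsAsymmetry B σ τ) (hS : ∀ x y, B (S x) (S y) = B x y) (hc : Commute S σ)
    {k : ℕ} (hk : Odd k) :
    LinearMap.det (S.restrict (map_mem_socle hc k)) =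
      LinearMap.det (S.restrict (map_mem_socle hc (k + 1))) := by
  have hN : Commute S (σ - 1) := hc.sub_right (Commute.one_right S)
  obtain ⟨g, hg⟩ := LinearMap.exists_rightInverse_of_surjective
    ((σ - 1) ^ k).rangeRestrict (LinearMap.range_rangeRestrict _)
  let ι : socle σ k →ₗ[F] LinearMap.range ((σ - 1) ^ k) := Submodule.inclusion inf_le_right
  have hg' : ∀ u : socle σ k, ((σ - 1) ^ k) (g (ι u)) = u := fun u =>
    congrArg Subtype.val (congrArg (fun f => f (ι u)) hg)
  have hgk : ∀ u : socle σ k, ((σ - 1) ^ (k + 1)) (g (ι u)) = 0 := fun u => by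
    rw [pow_succ', Module.End.mul_apply, hg']
    exact u.2.1
  let ω : socle σ k →ₗ[F] socle σ k →ₗ[F] F :=
    B.compl₁₂ (g ∘ₗ ι) (socle σ k).subtype
  have hω : ∀ u v, ω u v = B (g (ι u)) v := fun u v => rfl
  have hωx : ∀ x (u v : socle σ k), ((σ - 1) ^ k) x = u → B x v = ω u v := by
    intro x u v hx
    have h1 : ((σ - 1) ^ k) (x - g (ι u)) = 0 := by rw [map_sub, hx, hg', sub_self]
    have h2 : B (x - g (ι u)) v = 0 := by
      have h3 := h.apply_pow_comm k (hgk v)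
        (show ((σ - 1) ^ (k + 1)) (x - g (ι u)) = 0 by
          rw [pow_succ', Module.End.mul_apply, h1, map_zero])
      rwa [h1, hg', map_zero, mul_zero] at h3
    rwa [map_sub, LinearMap.sub_apply, sub_eq_zero] at h2
  have hskew : ∀ u v, ω v u = -ω u v := fun u v => by
    have := h.apply_pow_comm k (hgk u) (hgk v)
    rwa [hg', hg', hk.neg_one_pow, neg_one_mul] at this
  have halt : ω.IsAlt := fun u => by
    have h1 : (2 : F) * ω u u = 0 := by linear_combination hskew u u
    exact (mul_eq_zero.mp h1).resolve_left hchar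
  refine det_eq_det_of_range_eq_ker ω halt _ (fun u v => ?_)
    (Submodule.inclusion (socle_succ_le σ k)) (Submodule.inclusion_injective _) ?_ _
    fun x => rfl
  · rw [← hωx (S (g (ι u))), LinearMap.coe_restrict_apply, hS, hω]
    rw [← Module.End.mul_apply, ← (hN.pow_right k).eq, Module.End.mul_apply, hg']
    rfl
  · rw [Submodule.range_inclusion]
    ext u
    rw [Submodule.mem_comap, Submodule.subtype_apply, LinearMap.mem_ker]
    constructor
    · rintro ⟨-, w, hw⟩
      ext v
      rw [hskew, hω, ← hw, h.apply_pow_eq_zero _ (hgk v), neg_zero,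
        LinearMap.zero_apply]
    · intro hu
      refine ⟨u.2.1, h.mem_range_pow _ fun x hx => ?_⟩
      have hv : ((σ - 1) ^ k) x ∈ socle σ k :=
        ⟨by rwa [pow_succ'] at hx, LinearMap.mem_range_self _ _⟩
      rw [hωx x ⟨_, hv⟩ u rfl, hskew, hu, LinearMap.zero_apply, neg_zero]

theorem det_eq_one [FiniteDimensional F V] (hchar : (2 : F) ≠ 0)
    (h : IsAsymmetry B σ τ) (hS : ∀ x y, B (S x) (S y) = B x y)
    (hsurj : Function.Surjective S)
    (hz : ∀ k : ℕ, Even k → ∀ x, ((σ - 1) ^ (k + 1)) x = 0 → B x (((σ - 1) ^ k) x) = 0) :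
    LinearMap.det S = 1 := by
  have hc := h.commute_of_isometry hS hsurj
  have hcomm : ∀ x y, B x y = B y x → B ((σ - 1) y) x = 0 := fun x y hxy => by
    rw [LinearMap.sub_apply, map_sub, LinearMap.sub_apply, ← h.apply_comm, hxy]
    exact sub_self _
  have h0 : LinearMap.det S = LinearMap.det (S.restrict (map_mem_socle hc 0)) := by
    refine det_eq_det_of_range_eq_ker (B - B.flip) (fun x => ?_) S (fun x y => ?_)
      (socle σ 0).subtype (socle σ 0).injective_subtype ?_ _ fun x => rfl
    · simp
    · simp [hS]
    · rw [Submodule.range_subtype]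
      ext y
      simp only [socle, pow_zero, Submodule.mem_inf, LinearMap.mem_ker]
      constructor
      · rintro ⟨hy, -⟩
        ext x
        rw [LinearMap.sub_apply, Module.End.one_apply, sub_eq_zero] at hy
        simp [h.apply_comm x y, hy]
      · intro hy
        refine ⟨h.eq_of_left fun x => ?_, LinearMap.mem_range_self 1 y⟩
        rw [map_zero, LinearMap.zero_apply]
        refine hcomm _ _ ?_
        have := congrArg (fun f => f x) hy
        simp only [LinearMap.sub_apply, LinearMap.flip_apply, LinearMap.zero_apply] at this
        exact (sub_eq_zero.mp this).symm
  have hind : ∀ k, LinearMap.det S = LinearMap.det (S.restrict (map_mem_socle hc k)) := by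
    intro k
    induction k with
    | zero => exact h0
    | succ k ih =>
      rcases Nat.even_or_odd k with hk | hk
      · have heq := h.socle_eq_of_even hchar hk (hz k hk)
        rw [ih]
        exact det_restrict_congr heq _ _
      · rw [ih, h.det_restrict_socle_of_odd hchar hS hc hk]
  have hbot : socle σ (Module.finrank F V) = ⊥ := by
    rw [eq_bot_iff]
    rintro _ ⟨hx, w, rfl⟩
    have hw : w ∈ LinearMap.ker ((σ - 1) ^ (Module.finrank F V + 1)) := by
      rwa [LinearMap.mem_ker, pow_succ']
    rwa [Module.End.ker_pow_eq_ker_pow_finrank_of_le (Nat.le_succ _)] at hw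
  rw [hind (Module.finrank F V)]
  have : Subsingleton (socle σ (Module.finrank F V)) := by
    rw [hbot]; infer_instance
  exact LinearMap.det_eq_one_of_subsingleton _

end Isometry

end IsAsymmetry

section Blocks

variable {F : Type*} [Field F] {n r s : ℕ}

theorem reindex_dSum (h : r + s = n) (A : Matrix (Fin r) (Fin r) F) (B : Matrix (Fin s) (Fin s) F) :
    reindex (finCongr h) (finCongr h) (dSum A B) =
      (fromBlocks A 0 0 B).submatrix (finSumFinEquiv.trans (finCongr h)).symm
        (finSumFinEquiv.trans (finCongr h)).symm := rfl

theorem reindex_dSum_mul (h : r + s = n) (A C : Matrix (Fin r) (Fin r) F)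
    (B D : Matrix (Fin s) (Fin s) F) :
    reindex (finCongr h) (finCongr h) (dSum A B) * reindex (finCongr h) (finCongr h) (dSum C D) =
      reindex (finCongr h) (finCongr h) (dSum (A * C) (B * D)) := by
  simp only [reindex_dSum, submatrix_mul_equiv, fromBlocks_multiply]
  simp

theorem reindex_dSum_transpose (h : r + s = n) (A : Matrix (Fin r) (Fin r) F)
    (B : Matrix (Fin s) (Fin s) F) :
    (reindex (finCongr h) (finCongr h) (dSum A B))ᵀ =
      reindex (finCongr h) (finCongr h) (dSum Aᵀ Bᵀ) := by
  rw [reindex_dSum, reindex_dSum, transpose_submatrix, fromBlocks_transpose, transpose_zero,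
    transpose_zero]

theorem det_reindex_dSum (h : r + s = n) (A : Matrix (Fin r) (Fin r) F)
    (B : Matrix (Fin s) (Fin s) F) :
    (reindex (finCongr h) (finCongr h) (dSum A B)).det = A.det * B.det := by
  simp only [reindex_dSum, det_submatrix_equiv_self, det_fromBlocks_zero₁₂]

theorem exists_mul_eq_of_simSummand {M : Matrix (Fin n) (Fin n) F} {A : Matrix (Fin r) (Fin r) F}
    (h : SimSummand M A) :
    ∃ (X : Matrix (Fin n) (Fin r) F) (P : Matrix (Fin r) (Fin n) F),
      P * X = 1 ∧ M * X = X * A ∧ P * M = A * P := by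
  obtain ⟨s, hs, B, S, hS, hSM⟩ := h
  have hdet : IsUnit S.det := (isUnit_iff_isUnit_det S).mp hS
  rw [reindex_dSum] at hSM
  set e := (finSumFinEquiv.trans (finCongr hs)).symm
  have h1 : M * S = S * (fromBlocks A 0 0 B).submatrix e e := by
    rw [← hSM, Matrix.mul_assoc, mul_nonsing_inv_cancel_left _ _ hdet]
  have h2 : S⁻¹ * M = (fromBlocks A 0 0 B).submatrix e e * S⁻¹ := by
    rw [← hSM, mul_nonsing_inv_cancel_right _ _ hdet]
  refine ⟨S.submatrix id (e.symm ∘ Sum.inl), S⁻¹.submatrix (e.symm ∘ Sum.inl) id, ?_, ?_, ?_⟩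
  · rw [← submatrix_mul _ _ _ _ _ Function.bijective_id, nonsing_inv_mul _ hdet]
    exact submatrix_one _ (e.symm.injective.comp Sum.inl_injective)
  · have h3 : (M * S).submatrix id (e.symm ∘ Sum.inl) =
        (S.submatrix id e.symm * fromBlocks A 0 0 B).submatrix id Sum.inl := by
      rw [h1]
      ext i j
      simp [mul_apply, ← e.symm.sum_comp]
    ext i j
    have h4 := congrFun (congrFun h3 i) j
    simpa [mul_apply] using h4
  · have h3 : (S⁻¹ * M).submatrix (e.symm ∘ Sum.inl) id =
        (fromBlocks A 0 0 B * S⁻¹.submatrix e.symm id).submatrix Sum.inl id := by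
      rw [h2]
      ext i j
      simp [mul_apply, ← e.symm.sum_comp]
    ext i j
    have h4 := congrFun (congrFun h3 i) j
    simpa [mul_apply] using h4

theorem jordanBlock_one_sub_one_pow_apply (m : ℕ) (i j : Fin r) :
    ((jordanBlock r (1 : F) - 1) ^ m) i j = if (i : ℕ) = j + m then 1 else 0 := by
  induction m generalizing i j with
  | zero => simp [one_apply, Fin.ext_iff]
  | succ m ih =>
    have h1 : ∀ l : Fin r, (jordanBlock r (1 : F) - 1) l j =
        if (l : ℕ) = j + 1 then 1 else 0 := fun l => by
      by_cases h : (l : ℕ) = j <;> simp [jordanBlock, one_apply, Fin.ext_iff, h]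
    rw [pow_succ, mul_apply]
    simp only [ih, h1, mul_ite, mul_one, mul_zero]
    by_cases hj : (j : ℕ) + 1 < r
    · rw [Finset.sum_eq_single ⟨j + 1, hj⟩]
      · simp [add_assoc, add_comm 1 m]
      · intro l _ hl
        exact if_neg fun h => hl (Fin.ext h)
      · simp
    · rw [Finset.sum_eq_zero, if_neg (by omega)]
      intro l _
      exact if_neg (by omega)

end Blocks

section Asymmetry

variable {F : Type*} [Field F] {n : ℕ} {M : Matrix (Fin n) (Fin n) F}

theorem isAsymmetry_toBilin' (hM : IsUnit M) :
    IsAsymmetry (toBilin' M) (toLin' (M⁻¹ᵀ * M)) (toLin' (M⁻¹ * Mᵀ)) := by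
  have hdet : IsUnit M.det := (isUnit_iff_isUnit_det M).mp hM
  have hMt : Mᵀ * M⁻¹ᵀ = 1 := by rw [← transpose_mul, nonsing_inv_mul _ hdet, transpose_one]
  have hMt' : M⁻¹ᵀ * Mᵀ = 1 := by rw [← transpose_mul, mul_nonsing_inv _ hdet, transpose_one]
  refine ⟨LinearMap.ker_eq_bot'.mpr fun x hx => ?_, ?_, ?_, fun x y => ?_⟩
  · have h1 : x ᵥ* M = 0 := by
      refine dotProduct_eq_zero _ fun y => ?_
      rw [← dotProduct_mulVec, ← toBilin'_apply', hx, LinearMap.zero_apply]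
    have h2 := congrArg (· ᵥ* M⁻¹) h1
    simpa [vecMul_vecMul, mul_nonsing_inv _ hdet] using h2
  · rw [Module.End.mul_eq_comp, ← toLin'_mul, Matrix.mul_assoc,
      mul_nonsing_inv_cancel_left _ _ hdet, hMt']
    exact toLin'_one
  · rw [Module.End.mul_eq_comp, ← toLin'_mul, Matrix.mul_assoc,
      ← Matrix.mul_assoc Mᵀ, hMt, Matrix.one_mul, nonsing_inv_mul _ hdet]
    exact toLin'_one
  · rw [toBilin'_apply', toBilin'_apply', toLin'_apply, dotProduct_comm (_ *ᵥ y),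
      ← vecMul_transpose _ x, ← dotProduct_mulVec, mulVec_mulVec, ← Matrix.mul_assoc, hMt,
      Matrix.one_mul]

theorem exists_apply_ne_zero_of_simSummand (hchar : (2 : F) ≠ 0) (hM : IsUnit M) {k : ℕ}
    (hk : Even k) (h : SimSummand (M⁻¹ᵀ * M) (jordanBlock (k + 1) (1 : F))) :
    ∃ x, ((toLin' (M⁻¹ᵀ * M) - 1) ^ (k + 1)) x = 0 ∧
      toBilin' M x (((toLin' (M⁻¹ᵀ * M) - 1) ^ k) x) ≠ 0 := by
  by_contra! hz
  have hasym := isAsymmetry_toBilin' hM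
  obtain ⟨X, P, hPX, hX, hP⟩ := exists_mul_eq_of_simSummand h
  set N := M⁻¹ᵀ * M - 1 with hN
  set J := jordanBlock (k + 1) (1 : F) - 1 with hJ
  have hNl : ∀ m : ℕ, (toLin' (M⁻¹ᵀ * M) - 1) ^ m = toLin' (N ^ m) := fun m => by
    rw [toLin'_pow, hN, map_sub, toLin'_one]
    rfl
  have hNX : ∀ m : ℕ, N ^ m * X = X * J ^ m := fun m => by
    induction m with
    | zero => simp
    | succ m ih =>
      have h1 : N * X = X * J := by
        rw [hN, hJ, Matrix.sub_mul, Matrix.mul_sub, hX, Matrix.one_mul, Matrix.mul_one]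
      rw [pow_succ, pow_succ, Matrix.mul_assoc, h1, ← Matrix.mul_assoc, ih, Matrix.mul_assoc]
  have hPN : ∀ m : ℕ, P * N ^ m = J ^ m * P := fun m => by
    induction m with
    | zero => simp
    | succ m ih =>
      have h1 : P * N = J * P := by
        rw [hN, hJ, Matrix.sub_mul, Matrix.mul_sub, hP, Matrix.one_mul, Matrix.mul_one]
      rw [pow_succ, pow_succ, ← Matrix.mul_assoc, ih, Matrix.mul_assoc, h1, Matrix.mul_assoc]
  have hJ0 : J ^ (k + 1) = 0 := by
    ext i j
    rw [hJ, jordanBlock_one_sub_one_pow_apply, if_neg (by omega), Matrix.zero_apply]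
  set v : Fin (k + 1) → F := Pi.single 0 1 with hv
  have hker : (N ^ (k + 1)) *ᵥ (X *ᵥ v) = 0 := by
    rw [mulVec_mulVec, hNX, hJ0, Matrix.mul_zero, zero_mulVec]
  have hmem : (N ^ k) *ᵥ (X *ᵥ v) ∈ IsAsymmetry.socle (toLin' (M⁻¹ᵀ * M)) k := by
    refine ⟨?_, X *ᵥ v, by rw [hNl, toLin'_apply]⟩
    have h1 := hNl 1
    rw [pow_one, pow_one] at h1
    rw [h1]
    change toLin' N _ = 0
    rw [toLin'_apply, mulVec_mulVec, ← pow_succ', hker]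
  rw [hasym.socle_eq_of_even hchar hk hz] at hmem
  obtain ⟨-, w, hw⟩ := hmem
  rw [hNl, toLin'_apply] at hw
  have h2 : (J ^ k) *ᵥ v = 0 := by
    have h3 := congrArg (P *ᵥ ·) hw
    simp only [mulVec_mulVec] at h3
    rw [hPN, hJ0, Matrix.zero_mul, zero_mulVec, hNX, ← Matrix.mul_assoc, hPX,
      Matrix.one_mul] at h3
    exact h3.symm
  have h4 := congrFun h2 (Fin.last k)
  rw [hv, mulVec_single_one, Matrix.col_apply, hJ, jordanBlock_one_sub_one_pow_apply] at h4
  simp at h4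

/-- A Jordan chain on which the form does not degenerate. -/
theorem exists_mul_jordanBlock_of_apply_ne_zero (hM : IsUnit M) {k : ℕ} {x : Fin n → F}
    (hx : ((toLin' (M⁻¹ᵀ * M) - 1) ^ (k + 1)) x = 0)
    (hne : toBilin' M x (((toLin' (M⁻¹ᵀ * M) - 1) ^ k) x) ≠ 0) :
    ∃ X : Matrix (Fin n) (Fin (k + 1)) F, IsUnit (Xᵀ * M * X) ∧
      M⁻¹ᵀ * M * X = X * jordanBlock (k + 1) (1 : F) := by
  have hasym := isAsymmetry_toBilin' hM
  set σ : Module.End F (Fin n → F) := toLin' (M⁻¹ᵀ * M) with hσ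
  have hx' : ∀ m : ℕ, k + 1 ≤ m → ((σ - 1) ^ m) x = 0 := fun m hm => by
    obtain ⟨d, rfl⟩ := Nat.exists_eq_add_of_le' hm
    rw [pow_add, Module.End.mul_apply, hx, map_zero]
  let X : Matrix (Fin n) (Fin (k + 1)) F := of fun i j => ((σ - 1) ^ (j : ℕ)) x i
  have hcol : ∀ j, X.col j = ((σ - 1) ^ (j : ℕ)) x := fun j => rfl
  have hG : ∀ i j, (Xᵀ * M * X) i j =
      toBilin' M (((σ - 1) ^ (i : ℕ)) x) (((σ - 1) ^ (j : ℕ)) x) := fun i j => by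
    rw [toBilin'_apply', ← hcol, ← hcol, dotProduct_mulVec]
    rfl
  have hG' : ∀ i j : Fin (k + 1), k ≤ (i : ℕ) + j → (Xᵀ * M * X) i j =
      (-1) ^ (i : ℕ) * toBilin' M x (((σ - 1) ^ ((i : ℕ) + j)) x) := fun i j hij => by
    rw [hG, hasym.apply_sub_one_pow, hasym.inv_sub_one_pow_apply, ← Module.End.mul_apply, ← pow_add,
      map_zsmul]
    · simp
    · rw [← Module.End.mul_apply, ← pow_add]
      exact hx' _ (by omega)
  refine ⟨X, ?_, ?_⟩
  · rw [← isUnit_submatrix_equiv (Fin.revPerm (n := k + 1)) (Equiv.refl _),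
      isUnit_iff_isUnit_det, det_of_isLowerTriangular, isUnit_iff_ne_zero, Finset.prod_ne_zero_iff]
    · intro i _
      have hi : ((Fin.revPerm i : Fin (k + 1)) : ℕ) + i = k := by
        simp [Fin.val_rev]
        omega
      rw [submatrix_apply, Equiv.refl_apply, hG' _ _ hi.ge, hi]
      exact mul_ne_zero (by simp) hne
    · intro i j hij
      have hij' : (i : ℕ) < j := hij
      have hi : k + 1 ≤ ((Fin.revPerm i : Fin (k + 1)) : ℕ) + j := by
        simp [Fin.val_rev]
        omega
      rw [submatrix_apply, Equiv.refl_apply, hG' _ _ (by omega), hx' _ hi, map_zero, mul_zero]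
  · ext i j
    have h1 : (M⁻¹ᵀ * M * X) i j = σ (((σ - 1) ^ (j : ℕ)) x) i := by
      rw [← hcol, hσ, toLin'_apply]
      rfl
    have h2 : σ (((σ - 1) ^ (j : ℕ)) x) =
        ((σ - 1) ^ (j : ℕ)) x + ((σ - 1) ^ ((j : ℕ) + 1)) x := by
      rw [pow_succ' _ (j : ℕ), Module.End.mul_apply, LinearMap.sub_apply]
      simp
    rw [h1, h2, mul_apply]
    simp only [jordanBlock, of_apply, X]
    rw [Pi.add_apply]
    have h3 : ∀ l : Fin (k + 1), ((σ - 1) ^ (l : ℕ)) x i *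
        (if (l : ℕ) = j then (1 : F) else if (l : ℕ) = j + 1 then 1 else 0) =
        (if l = j then ((σ - 1) ^ (j : ℕ)) x i else 0) +
          (if (l : ℕ) = j + 1 then ((σ - 1) ^ ((j : ℕ) + 1)) x i else 0) := fun l => by
      by_cases h4 : l = j
      · simp [h4]
      · by_cases h5 : (l : ℕ) = j + 1
        · simp [h5, h4]
        · simp [h5, h4, Fin.val_inj]
    simp only [h3]
    rw [Finset.sum_add_distrib, Finset.sum_ite_eq' _ j, if_pos (Finset.mem_univ _)]
    congr 1
    by_cases hj : (j : ℕ) + 1 < k + 1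
    · rw [Finset.sum_eq_single ⟨j + 1, hj⟩]
      · simp
      · intro l _ hl
        exact if_neg fun h => hl (Fin.ext h)
      · simp
    · rw [hx' _ (by omega), Finset.sum_eq_zero]
      · rfl
      · intro l _
        exact if_neg (by omega)

/-- A Jordan chain on which the form does not degenerate splits off for congruence. -/
theorem exists_congruent_dSum {r : ℕ} (hM : IsUnit M)
    {X : Matrix (Fin n) (Fin r) F} {J : Matrix (Fin r) (Fin r) F} (hG : IsUnit (Xᵀ * M * X))
    (hX : M⁻¹ᵀ * M * X = X * J) :
    ∃ (s : ℕ) (h : r + s = n) (H : Matrix (Fin s) (Fin s) F) (T : Matrix (Fin n) (Fin n) F),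
      IsUnit T ∧ (Xᵀ * M * X)ᵀ * J = Xᵀ * M * X ∧
      Tᵀ * M * T = reindex (finCongr h) (finCongr h) (dSum (Xᵀ * M * X) H) := by
  have hdet : IsUnit M.det := (isUnit_iff_isUnit_det M).mp hM
  have hMt : Mᵀ * M⁻¹ᵀ = 1 := by rw [← transpose_mul, nonsing_inv_mul _ hdet, transpose_one]
  have hMX : M * X = Mᵀ * X * J := by
    rw [Matrix.mul_assoc, ← hX, Matrix.mul_assoc, ← Matrix.mul_assoc Mᵀ, hMt, Matrix.one_mul]
  have hGinj := mulVec_injective_iff_isUnit.mpr hG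
  let p := toLin' (Xᵀ * M)
  have hsurj : LinearMap.range p = ⊤ := by
    refine LinearMap.range_eq_top.mpr fun y => ?_
    obtain ⟨a, ha⟩ := mulVec_surjective_iff_isUnit.mpr hG y
    exact ⟨X *ᵥ a, by rw [toLin'_apply, mulVec_mulVec, ha]⟩
  have hdim : r + Module.finrank F (LinearMap.ker p) = n := by
    have := p.finrank_range_add_finrank_ker
    rwa [hsurj, finrank_top, Module.finrank_fin_fun, Module.finrank_fin_fun] at this
  let b := Module.finBasis F (LinearMap.ker p)
  let Y : Matrix (Fin n) (Fin (Module.finrank F (LinearMap.ker p))) F :=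
    of fun i j => (b j : Fin n → F) i
  have hY : ∀ c, Y *ᵥ c = ((∑ j, c j • b j : LinearMap.ker p) : Fin n → F) := fun c => by
    ext i
    simp [Y, mulVec, dotProduct, mul_comm]
  have hXMY : Xᵀ * M * Y = 0 := by
    ext i j
    exact congrFun (LinearMap.mem_ker.mp (b j).2) i
  have hYMX : Yᵀ * M * X = 0 := by
    rw [Matrix.mul_assoc, hMX, ← Matrix.mul_assoc]
    have := congrArg transpose hXMY
    rw [transpose_mul, transpose_mul, transpose_transpose, transpose_zero] at this
    rw [this, Matrix.zero_mul]
  let e := finSumFinEquiv.trans (finCongr hdim)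
  refine ⟨_, hdim, Yᵀ * M * Y, (fromCols X Y).submatrix id e.symm, ?_, ?_, ?_⟩
  · rw [← mulVec_injective_iff_isUnit]
    refine (injective_iff_map_eq_zero (mulVecLin _)).mpr fun a ha => ?_
    rw [mulVecLin_apply, ← Equiv.symm_symm e] at ha
    have ha' : X *ᵥ (a ∘ e ∘ Sum.inl) + Y *ᵥ (a ∘ e ∘ Sum.inr) = 0 := by
      rw [← ha, ← Function.comp_assoc, ← Function.comp_assoc, ← fromCols_mulVec]
      ext i
      simp [mulVec, dotProduct, ← e.sum_comp]
    have h1 : a ∘ e ∘ Sum.inl = 0 := by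
      apply hGinj
      have h2 := congrArg ((Xᵀ * M) *ᵥ ·) ha'
      simp only [mulVec_add, mulVec_mulVec, hXMY, zero_mulVec, add_zero, mulVec_zero] at h2
      rw [h2, mulVec_zero]
    rw [h1, mulVec_zero, zero_add, hY, ZeroMemClass.coe_eq_zero] at ha'
    have h3 := Fintype.linearIndependent_iff.mp b.linearIndependent _ ha'
    ext i
    obtain ⟨i, rfl⟩ := e.surjective i
    rcases i with i | i
    · exact congrFun h1 i
    · exact h3 i
  · rw [transpose_mul, transpose_mul, transpose_transpose, Matrix.mul_assoc, Matrix.mul_assoc,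
      ← Matrix.mul_assoc Mᵀ, ← hMX, Matrix.mul_assoc]
  · rw [reindex_dSum, transpose_submatrix, transpose_fromCols]
    change _ = (fromBlocks (Xᵀ * M * X) 0 0 (Yᵀ * M * Y)).submatrix e.symm e.symm
    rw [← hXMY, ← hYMX, ← fromRows_mul_fromCols, ← fromRows_mul]
    rfl

theorem dSum_of_apply_ne_zero (hchar : (2 : F) ≠ 0) (hM : IsUnit M) {k : ℕ} (hk : Even k)
    {x : Fin n → F} (hx : ((toLin' (M⁻¹ᵀ * M) - 1) ^ (k + 1)) x = 0)
    (hne : toBilin' M x (((toLin' (M⁻¹ᵀ * M) - 1) ^ k) x) ≠ 0) :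
    ¬ XiMem M ∧ SimSummand (M⁻¹ᵀ * M) (jordanBlock (k + 1) (1 : F)) := by
  have hdet : IsUnit M.det := (isUnit_iff_isUnit_det M).mp hM
  have hMt : Mᵀ * M⁻¹ᵀ = 1 := by rw [← transpose_mul, nonsing_inv_mul _ hdet, transpose_one]
  obtain ⟨X, hG, hX⟩ := exists_mul_jordanBlock_of_apply_ne_zero hM hx hne
  obtain ⟨s, h, H, T, hT, hGJ, hTM⟩ := exists_congruent_dSum hM hG hX
  set G := Xᵀ * M * X
  have hTdet : IsUnit T.det := (isUnit_iff_isUnit_det T).mp hT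
  have hTt : T⁻¹ᵀ * Tᵀ = 1 := by rw [← transpose_mul, mul_nonsing_inv _ hTdet, transpose_one]
  constructor
  · intro hXi
    set D := reindex (finCongr h) (finCongr h)
      (dSum (-1 : Matrix (Fin (k + 1)) (Fin (k + 1)) F) (1 : Matrix (Fin s) (Fin s) F)) with hD
    have hDM : Dᵀ * (Tᵀ * M * T) * D = Tᵀ * M * T := by
      rw [hTM, hD, reindex_dSum_transpose, reindex_dSum_mul, reindex_dSum_mul]
      simp
    have hdetD : D.det = -1 := by
      rw [hD, det_reindex_dSum, det_neg, det_one, det_one, Fintype.card_fin, pow_succ,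
        hk.neg_one_pow]
      simp
    have hS : (T * D * T⁻¹).det = -1 := by
      rw [det_mul, det_mul, hdetD, mul_neg_one, neg_mul, ← det_mul, mul_nonsing_inv _ hTdet,
        det_one]
    have h1 := hXi (T * D * T⁻¹) ((isUnit_iff_isUnit_det _).mpr (by rw [hS]; simp)) (by
      calc (T * D * T⁻¹)ᵀ * M * (T * D * T⁻¹)
          = T⁻¹ᵀ * (Dᵀ * (Tᵀ * M * T) * D) * T⁻¹ := by
            simp only [transpose_mul, Matrix.mul_assoc]
        _ = (T⁻¹ᵀ * Tᵀ) * M * (T * T⁻¹) := by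
            rw [hDM]
            simp only [Matrix.mul_assoc]
        _ = M := by rw [hTt, mul_nonsing_inv _ hTdet, Matrix.one_mul, Matrix.mul_one])
    rw [hS] at h1
    exact hchar (by linear_combination -h1)
  · have hK : IsUnit (Tᵀ * M * T) := by
      rw [isUnit_iff_isUnit_det, det_mul, det_mul, det_transpose]
      exact (hTdet.mul hdet).mul hTdet
    have hH : IsUnit H.det := by
      rw [hTM, isUnit_iff_isUnit_det, det_reindex_dSum] at hK
      exact isUnit_of_mul_isUnit_right hK
    have hHt : Hᵀ * H⁻¹ᵀ = 1 := by rw [← transpose_mul, nonsing_inv_mul _ hH, transpose_one]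
    refine ⟨s, h, H⁻¹ᵀ * H, T, hT, ?_⟩
    set D := reindex (finCongr h) (finCongr h) (dSum (jordanBlock (k + 1) (1 : F)) (H⁻¹ᵀ * H))
      with hD
    have h1 : (Tᵀ * M * T)ᵀ * D = Tᵀ * M * T := by
      rw [hTM, hD, reindex_dSum_transpose, reindex_dSum_mul, hGJ, ← Matrix.mul_assoc, hHt,
        Matrix.one_mul]
    have h2 : (Tᵀ * M * T)ᵀ * (T⁻¹ * (M⁻¹ᵀ * M) * T) = Tᵀ * M * T := by
      calc (Tᵀ * M * T)ᵀ * (T⁻¹ * (M⁻¹ᵀ * M) * T)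
          = Tᵀ * (Mᵀ * (T * T⁻¹) * M⁻¹ᵀ) * M * T := by
            simp only [transpose_mul, transpose_transpose, Matrix.mul_assoc]
        _ = Tᵀ * M * T := by
            rw [mul_nonsing_inv _ hTdet, Matrix.mul_one, hMt, Matrix.mul_one]
    exact ((Tᵀ * M * T).isUnit_transpose.2 hK).mul_left_cancel (h2.trans h1.symm)

theorem xiMem_of_forall_apply_eq_zero (hchar : (2 : F) ≠ 0) (hM : IsUnit M)
    (hz : ∀ k : ℕ, Even k → ∀ x, ((toLin' (M⁻¹ᵀ * M) - 1) ^ (k + 1)) x = 0 →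
      toBilin' M x (((toLin' (M⁻¹ᵀ * M) - 1) ^ k) x) = 0) : XiMem M := by
  intro S hS hSM
  rw [← LinearMap.det_toLin']
  refine (isAsymmetry_toBilin' hM).det_eq_one hchar (fun x y => ?_)
    (mulVec_surjective_iff_isUnit.mpr hS) hz
  rw [toBilin'_apply', toBilin'_apply', toLin'_apply, toLin'_apply, ← vecMul_transpose,
    ← dotProduct_mulVec, mulVec_mulVec, mulVec_mulVec, hSM]

end Asymmetry

/-- for invertible `M`, `M ∉ Ξ_n(F)` iff `M⁻ᵀM` has a direct summand for
similarity of the form `J_r(1)` with `r` odd. -/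
theorem stmt_9 {F : Type*} [Field F] (hchar : (2 : F) ≠ 0) {n : ℕ}
    (M : Matrix (Fin n) (Fin n) F) (hM : IsUnit M) :
    ¬ XiMem M ↔ ∃ r : ℕ, Odd r ∧ SimSummand (M⁻¹ᵀ * M) (jordanBlock r (1 : F)) := by
  constructor
  · contrapose!
    intro h
    refine xiMem_of_forall_apply_eq_zero hchar hM fun k hk x hx => ?_
    by_contra hne
    exact h (k + 1) hk.add_one (dSum_of_apply_ne_zero hchar hM hk hx hne).2
  · rintro ⟨r, hr, h⟩
    obtain ⟨k, rfl⟩ := Nat.exists_eq_add_of_le' hr.pos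
    have hk : Even k := by rwa [Nat.odd_add_one, Nat.not_odd_iff_even] at hr
    obtain ⟨x, hx, hne⟩ := exists_apply_ne_zero_of_simSummand hchar hM hk h
    exact (dSum_of_apply_ne_zero hchar hM hk hx hne).1
end

section
/- Let F be a field of characteristic different from 2, let p(x) be a monic irreducible polynomial over F of degree s, let l ≥ 1, and let Φ be the m×m companion matrix of p(x)^l (so m = sl). Then Φ is a cosquare (i.e., Φ = A^{-T}A for some invertible m×m matrix A) if and only if p(x) ≠ x, p(x) ≠ x + (−1)^{m+1}, and p(x) = p^∨(x). -/
open Matrix Polynomial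

variable {F : Type*} [Field F]

open AdjoinRoot

theorem exists_basis_leftMulMatrix_root_eq_companion {q : F[X]} (hq : q.Monic) :
    ∃ b : Module.Basis (Fin q.natDegree) F (AdjoinRoot q),
      Algebra.leftMulMatrix b (root q) = companion q := by
  have h := (powerBasis' hq).leftMulMatrix
  have hmin : (powerBasis' hq).minpolyGen = q := by
    rw [PowerBasis.minpolyGen_eq]
    exact minpoly_powerBasis_gen_of_monic hq
  rw [hmin] at h
  refine ⟨(powerBasis' hq).basis, h.trans ?_⟩
  ext i j
  have hj : (j : ℕ) < q.natDegree := j.2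
  have hiff : (j : ℕ) + 1 = (powerBasis' hq).dim ↔ (j : ℕ) = q.natDegree - 1 := by
    change (j : ℕ) + 1 = q.natDegree ↔ _
    omega
  simp only [Matrix.of_apply, hiff]
  rfl

theorem isCosquare_iff_exists_eq_transpose_mul {m : ℕ} (A : Matrix (Fin m) (Fin m) F) :
    IsCosquare A ↔ ∃ Q : Matrix (Fin m) (Fin m) F, Q.det ≠ 0 ∧ Q = Qᵀ * A := by
  refine exists_congr fun Q => ?_
  rw [Matrix.isUnit_iff_isUnit_det, isUnit_iff_ne_zero]
  refine and_congr_right fun hQ => ?_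
  have hQT : IsUnit Qᵀ.det := by rwa [Matrix.det_transpose, isUnit_iff_ne_zero]
  rw [Matrix.transpose_nonsing_inv]
  constructor
  · rintro rfl
    rw [Matrix.mul_nonsing_inv_cancel_left _ _ hQT]
  · intro h
    conv_lhs => rw [h]
    rw [← h]
    nth_rewrite 2 [h]
    rw [Matrix.nonsing_inv_mul_cancel_left _ _ hQT]

theorem isCosquare_companion_iff_exists_bilinForm {q : F[X]} (hq : q.Monic) :
    IsCosquare (companion q) ↔ ∃ B : LinearMap.BilinForm F (AdjoinRoot q),
      B.Nondegenerate ∧ ∀ u v, B u v = B (root q * v) u := by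
  obtain ⟨b, hb⟩ := exists_basis_leftMulMatrix_root_eq_companion hq
  have key (B : LinearMap.BilinForm F (AdjoinRoot q)) :
      (LinearMap.BilinForm.toMatrix b B =
        (LinearMap.BilinForm.toMatrix b B)ᵀ * companion q) ↔
      ∀ u v, B u v = B (root q * v) u := by
    have hT : (LinearMap.BilinForm.toMatrix b B)ᵀ =
        LinearMap.BilinForm.toMatrix b B.flip := by
      ext i j
      simp [LinearMap.BilinForm.toMatrix_apply]
    rw [hT, ← hb, Algebra.leftMulMatrix_apply,
      ← LinearMap.BilinForm.toMatrix_compRight, EmbeddingLike.apply_eq_iff_eq]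
    constructor
    · intro h u v
      conv_lhs => rw [h]
      simp
    · intro h
      ext u v
      rw [h]
      simp
  rw [isCosquare_iff_exists_eq_transpose_mul]
  constructor
  · rintro ⟨Q, hdet, hQ⟩
    obtain ⟨B, rfl⟩ := (LinearMap.BilinForm.toMatrix b).surjective Q
    exact ⟨B, (LinearMap.BilinForm.nondegenerate_iff_det_ne_zero _).2 hdet, (key B).1 hQ⟩
  · rintro ⟨B, hB, h⟩
    exact ⟨LinearMap.BilinForm.toMatrix b B,
      (LinearMap.BilinForm.nondegenerate_iff_det_ne_zero _).1 hB, (key B).2 h⟩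

theorem exists_root_mul_eq_one {q : F[X]} (h0 : q.coeff 0 ≠ 0) :
    ∃ r : AdjoinRoot q, root q * r = 1 := by
  refine ⟨mk q (C (-(q.coeff 0)⁻¹) * q.divX), ?_⟩
  rw [← mk_X, ← map_mul, ← map_one (mk q), mk_eq_mk]
  refine ⟨C (-(q.coeff 0)⁻¹), ?_⟩
  have hC : (C (q.coeff 0)⁻¹ : F[X]) * C (q.coeff 0) = 1 := by
    rw [← C_mul, inv_mul_cancel₀ h0, C_1]
  have hdiv := divX_mul_X_add q
  simp only [map_neg]
  linear_combination hC - C (q.coeff 0)⁻¹ * hdiv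

theorem aeval_reverse_mul_pow {K : Type*} [CommRing K] [Algebra F K] {t r : K} (h : t * r = 1)
    (f : F[X]) : aeval r f * t ^ f.natDegree = aeval t f.reverse := by
  let _ : Invertible r := ⟨t, h, by rwa [mul_comm]⟩
  have h1 := eval₂_reverse_mul_pow (algebraMap F K) r f
  have h2 : eval₂ (algebraMap F K) (⅟r) f.reverse = aeval t f.reverse := rfl
  rw [h2] at h1
  rw [aeval_def, ← h1, mul_assoc, ← mul_pow, mul_comm r, h, one_pow, mul_one]

theorem bilinForm_aeval_mul {K : Type*} [CommRing K] [Algebra F K] {t r : K}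
    {B : LinearMap.BilinForm F K} (h : ∀ u v, B (t * u) v = B u (r * v)) (f : F[X]) (u v : K) :
    B (aeval t f * u) v = B u (aeval r f * v) := by
  induction f using Polynomial.induction_on' with
  | add f g hf hg => simp [add_mul, hf, hg]
  | monomial n a =>
    have hn : ∀ (n : ℕ) (u v : K), B (t ^ n * u) v = B u (r ^ n * v) := by
      intro n
      induction n with
      | zero => simp
      | succ n ih => intro u v; rw [pow_succ', mul_assoc, h, ih, ← mul_assoc, pow_succ]
    simp only [aeval_monomial, ← Algebra.smul_def, smul_mul_assoc, map_smul, LinearMap.smul_apply, hn]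

theorem inv_sub_pow_eq {K : Type*} [CommRing K] {t r e : K} (h : t * r = 1) (he : e * e = 1)
    {k : ℕ} (hk : (t - e) ^ (k + 1) = 0) :
    r * (t - e) ^ k = e * (t - e) ^ k ∧ (r - e) ^ k = (-1) ^ k * (t - e) ^ k := by
  have h1 : r * (t - e) ^ k = e * (t - e) ^ k := by
    rw [pow_succ] at hk
    linear_combination (-r * e) * hk + (e * (t - e) ^ k) * h - (r * (t - e) ^ k) * he
  refine ⟨h1, ?_⟩
  have h2 : ∀ n : ℕ, r ^ n * (t - e) ^ k = e ^ n * (t - e) ^ k := by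
    intro n
    induction n with
    | zero => simp
    | succ n ih => rw [pow_succ, mul_assoc, h1]; linear_combination e * ih
  have h3 : r - e = (-e) * (r * (t - e)) := by linear_combination r * (-he) + e * h
  rw [h3, mul_pow, mul_pow, h2, ← mul_assoc, ← mul_pow, neg_mul, he]

theorem coeff_zero_ne_zero_of_irreducible {p : F[X]} (hp : p.Monic) (hirr : Irreducible p)
    (hX : p ≠ X) : p.coeff 0 ≠ 0 := fun h =>
  hX (eq_of_monic_of_associated hp monic_X
    ((irreducible_X.associated_of_dvd hirr (X_dvd_iff.2 h)).symm))

theorem reverse_pow_of_domain (p : F[X]) (l : ℕ) : (p ^ l).reverse = p.reverse ^ l := by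
  induction l with
  | zero => simp only [pow_zero, ← C_1, reverse_C]
  | succ n ih => rw [pow_succ, pow_succ, reverse_mul_of_domain, ih]

theorem eq_C_inv_mul_reverse_of_dvd_reverse {p : F[X]} (hp : p.Monic) (h0 : p.coeff 0 ≠ 0)
    (h : p ∣ p.reverse) : p = C (p.coeff 0)⁻¹ * p.reverse := by
  have hlead : p.reverse.leadingCoeff = p.coeff 0 := by
    rw [reverse_leadingCoeff, trailingCoeff, natTrailingDegree_eq_zero.2 (Or.inr h0)]
  exact eq_of_dvd_of_natDegree_le_of_leadingCoeff (p := p) (q := C (p.coeff 0)⁻¹ * p.reverse)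
    (h.mul_left _) ((natDegree_C_mul_le _ _).trans (reverse_natDegree_le p))
    (by rw [leadingCoeff_mul, leadingCoeff_C, hlead, hp.leadingCoeff, inv_mul_cancel₀ h0])

theorem exists_mul_eq_pow_of_ne_zero {p : F[X]} (hirr : Irreducible p) {k : ℕ}
    {w : AdjoinRoot (p ^ (k + 1))} (hw : w ≠ 0) : ∃ h, h * w = mk (p ^ (k + 1)) (p ^ k) := by
  induction w using AdjoinRoot.induction_on with
  | ih f =>
    rw [Ne, mk_eq_zero] at hw
    have hsub : ∃ a b, p ^ k = a * f + b * p ^ (k + 1) := by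
      suffices h : p ^ k ∈ Ideal.span {f, p ^ (k + 1)} by
        obtain ⟨a, b, hab⟩ := Ideal.mem_span_pair.1 h
        exact ⟨a, b, hab.symm⟩
      obtain ⟨d, hd⟩ := (IsPrincipalIdealRing.principal (Ideal.span {f, p ^ (k + 1)})).principal
      rw [hd, Ideal.submodule_span_eq, Ideal.mem_span_singleton]
      rw [Ideal.submodule_span_eq] at hd
      have hdf : d ∣ f := by
        rw [← Ideal.mem_span_singleton, ← hd]
        exact Ideal.subset_span (by simp)
      have hdp : d ∣ p ^ (k + 1) := by
        rw [← Ideal.mem_span_singleton, ← hd]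
        exact Ideal.subset_span (by simp)
      obtain ⟨i, hi, hdi⟩ := (dvd_prime_pow hirr.prime _).1 hdp
      have hik : i ≤ k := by
        by_contra hcon
        obtain rfl : i = k + 1 := by omega
        exact hw (hdi.symm.dvd.trans hdf)
      exact hdi.dvd.trans (pow_dvd_pow p hik)
    obtain ⟨a, b, hab⟩ := hsub
    refine ⟨mk _ a, ?_⟩
    rw [← map_mul, mk_eq_mk]
    exact ⟨-b, by rw [hab]; ring⟩

section

variable {p : F[X]} {k : ℕ} {e : F}

theorem root_sub_pow_succ_eq_zero (hpe : p = X - C e) :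
    (root (p ^ (k + 1)) - algebraMap F _ e) ^ (k + 1) = 0 := by
  subst hpe
  have h := mk_self (f := (X - C e) ^ (k + 1))
  rw [map_pow, map_sub, mk_X, mk_C] at h
  exact h

theorem mk_pow_eq_root_sub_pow (hpe : p = X - C e) :
    mk (p ^ (k + 1)) (p ^ k) = (root (p ^ (k + 1)) - algebraMap F _ e) ^ k := by
  have h {K : Type _} [CommRing K] [Algebra F K] (x : K) : aeval x p = x - algebraMap F _ e := by
    simp [hpe]
  rw [← aeval_eq, map_pow, h]

theorem root_sub_pow_ne_zero (hirr : Irreducible p) (hpe : p = X - C e) :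
    (root (p ^ (k + 1)) - algebraMap F _ e) ^ k ≠ 0 := by
  rw [← mk_pow_eq_root_sub_pow hpe, Ne, mk_eq_zero,
    pow_dvd_pow_iff hirr.ne_zero hirr.not_isUnit]
  omega

end

theorem bilinForm_root_mul_root {K : Type*} [CommRing K] [Algebra F K] {t r : K}
    {B : LinearMap.BilinForm F K} (hB : ∀ u v, B u v = B (t * v) u) (h : t * r = 1) (u v : K) :
    B (t * u) v = B u (r * v) := by
  rw [hB u, ← mul_assoc, h, one_mul, hB v]

theorem aeval_eq_zero_of_bilinForm {K : Type*} [CommRing K] [Algebra F K] {t r : K}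
    {B : LinearMap.BilinForm F K} (hnd : B.Nondegenerate)
    (h : ∀ u v, B (t * u) v = B u (r * v)) {f : F[X]} (hf : aeval t f = 0) : aeval r f = 0 := by
  refine hnd.2 _ fun u => ?_
  rw [← mul_one (aeval r f), ← bilinForm_aeval_mul h, hf, zero_mul, map_zero, LinearMap.zero_apply]

theorem sub_pow_eq_zero_of_bilinForm {K : Type*} [CommRing K] [Algebra F K] {t r : K}
    (hchar : (2 : F) ≠ 0) {B : LinearMap.BilinForm F K} (hnd : B.Nondegenerate)
    (hB : ∀ u v, B u v = B (t * v) u) (h : t * r = 1) (hgen : ∀ u : K, ∃ f : F[X], aeval t f = u)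
    {k : ℕ} (hk : (t - algebraMap F K ((-1) ^ (k + 1))) ^ (k + 1) = 0) :
    (t - algebraMap F K ((-1) ^ (k + 1))) ^ k = 0 := by
  have he : ((-1) ^ (k + 1) : F) * (-1) ^ (k + 1) = 1 := by rw [← mul_pow]; simp
  have hsign : (-1 : F) ^ k * (-1) ^ (k + 1) = -1 := by
    rw [pow_succ, ← mul_assoc, ← mul_pow]; simp
  set e : F := (-1) ^ (k + 1)
  have he' : algebraMap F K e * algebraMap F K e = 1 := by rw [← map_mul, he, map_one]
  obtain ⟨hr, hs⟩ := inv_sub_pow_eq h he' hk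
  have hadj := bilinForm_root_mul_root hB h
  set w := (t - algebraMap F K e) ^ k with hw
  have htw : t * w = e • w := by
    rw [Algebra.smul_def]
    rw [pow_succ, ← hw] at hk
    linear_combination hk
  have h1 : B w 1 = (-1) ^ k * B 1 w := by
    have h2 := bilinForm_aeval_mul hadj ((X - C e) ^ k) 1 1
    simp only [map_pow, map_sub, aeval_X, aeval_C, mul_one, ← hw, hs] at h2
    rw [h2, show ((-1) ^ k * w : K) = ((-1) ^ k : F) • w by simp [Algebra.smul_def], map_smul,
      smul_eq_mul]
  have h3 : B 1 w = e * B w 1 := by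
    rw [hB, htw, map_smul, LinearMap.smul_apply, smul_eq_mul]
  have h4 : B 1 w = 0 := by
    have : 2 * B 1 w = 0 := by
      linear_combination h3 + e * h1 + hsign * B 1 w
    exact (mul_eq_zero.1 this).resolve_left hchar
  refine hnd.2 _ fun u => ?_
  obtain ⟨f, rfl⟩ := hgen u
  rw [← mul_one (aeval t f), bilinForm_aeval_mul hadj]
  have hrw : r * w = e • w := by rw [hr, Algebra.smul_def]
  induction f using Polynomial.induction_on' with
  | add f g hf hg => rw [map_add, add_mul, map_add, hf, hg, add_zero]
  | monomial n a =>
    have hn : r ^ n * w = e ^ n • w := by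
      induction n with
      | zero => simp
      | succ n ih => rw [pow_succ', mul_assoc, ih, mul_smul_comm, hrw, smul_smul, pow_succ]
    rw [aeval_monomial, mul_assoc, hn, ← Algebra.smul_def, map_smul, map_smul, h4, smul_zero,
      smul_zero]

theorem conditions_of_bilinForm (hchar : (2 : F) ≠ 0) {p : F[X]} (hp : p.Monic)
    (hirr : Irreducible p) {k : ℕ} {B : LinearMap.BilinForm F (AdjoinRoot (p ^ (k + 1)))}
    (hnd : B.Nondegenerate) (hB : ∀ u v, B u v = B (root (p ^ (k + 1)) * v) u) :
    p ≠ X ∧ p ≠ X + C ((-1 : F) ^ ((p ^ (k + 1)).natDegree + 1)) ∧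
      p = C (p.coeff 0)⁻¹ * p.reverse := by
  have hX : p ≠ X := by
    intro hpX
    have hne := root_sub_pow_ne_zero (k := k) (e := 0) hirr (by simpa using hpX)
    have h0 := root_sub_pow_succ_eq_zero (k := k) (e := 0) (p := p) (by simpa using hpX)
    simp only [map_zero, sub_zero] at hne h0
    refine hne (hnd.2 _ fun u => ?_)
    rw [hB, ← pow_succ', h0, map_zero, LinearMap.zero_apply]
  have hc := coeff_zero_ne_zero_of_irreducible hp hirr hX
  obtain ⟨r, hr⟩ := exists_root_mul_eq_one (q := p ^ (k + 1)) (by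
    rw [coeff_zero_eq_eval_zero, eval_pow, ← coeff_zero_eq_eval_zero]; exact pow_ne_zero _ hc)
  refine ⟨hX, ?_, ?_⟩
  · intro hpe
    have hdeg : (p ^ (k + 1)).natDegree = k + 1 := by
      rw [natDegree_pow, hpe, natDegree_X_add_C, mul_one]
    rw [hdeg] at hpe
    have hpe' : p = X - C ((-1) ^ (k + 1)) := by
      conv_lhs => rw [hpe]
      rw [pow_succ _ (k + 1), mul_neg_one, map_neg, sub_eq_add_neg]
    refine root_sub_pow_ne_zero (k := k) hirr hpe' ?_
    refine sub_pow_eq_zero_of_bilinForm hchar hnd hB hr (fun u => ?_)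
      (root_sub_pow_succ_eq_zero hpe')
    induction u using AdjoinRoot.induction_on with
    | ih f => exact ⟨f, aeval_eq f⟩
  · refine eq_C_inv_mul_reverse_of_dvd_reverse hp hc ?_
    have h0 : aeval r (p ^ (k + 1)) = 0 :=
      aeval_eq_zero_of_bilinForm hnd (bilinForm_root_mul_root hB hr) (by rw [aeval_eq, mk_self])
    have h1 := aeval_reverse_mul_pow hr (p ^ (k + 1))
    rw [h0, zero_mul, aeval_eq, eq_comm, mk_eq_zero, reverse_pow_of_domain] at h1
    exact hirr.prime.dvd_of_dvd_pow ((dvd_pow_self p k.succ_ne_zero).trans h1)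

theorem aeval_inv_root_of_eq_reverse {K : Type*} [CommRing K] [Algebra F K] {t r : K}
    (h : t * r = 1) {p : F[X]} (hc : p.coeff 0 ≠ 0) (hrev : p = C (p.coeff 0)⁻¹ * p.reverse) :
    aeval r p = algebraMap F K (p.coeff 0) * r ^ p.natDegree * aeval t p := by
  have h1 := aeval_reverse_mul_pow h p
  have h2 : aeval t p = algebraMap F K (p.coeff 0)⁻¹ * aeval t p.reverse := by
    conv_lhs => rw [hrev]
    rw [map_mul, aeval_C]
  have h3 : algebraMap F K (p.coeff 0) * algebraMap F K (p.coeff 0)⁻¹ = 1 := by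
    rw [← map_mul, mul_inv_cancel₀ hc, map_one]
  have h4 : t ^ p.natDegree * r ^ p.natDegree = 1 := by rw [← mul_pow, h, one_pow]
  rw [h2, ← h1]
  linear_combination (-aeval r p) * h4 - (aeval r p * t ^ p.natDegree * r ^ p.natDegree) * h3

/-- The involution `w ↦ t⁻¹ σ(w)` is not `-1` on the minimal ideal of `F[X] / (p ^ (k + 1))`. -/
theorem exists_add_inv_mul_ne_zero (hchar : (2 : F) ≠ 0) {p : F[X]} (hp : p.Monic)
    (hirr : Irreducible p) {k : ℕ} (hne : p ≠ X + C ((-1 : F) ^ ((p ^ (k + 1)).natDegree + 1)))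
    {r : AdjoinRoot (p ^ (k + 1))} (hr : root (p ^ (k + 1)) * r = 1)
    (σ : AdjoinRoot (p ^ (k + 1)) →ₐ[F] AdjoinRoot (p ^ (k + 1)))
    (hσ : σ (root (p ^ (k + 1))) = r) :
    ∃ g, mk _ (p ^ k) * g + r * σ (mk _ (p ^ k) * g) ≠ 0 := by
  by_contra! hall
  have h1 := hall 1
  have h2 := hall (root _)
  rw [mul_one] at h1
  rw [map_mul, hσ] at h2
  have h3 : mk (p ^ (k + 1)) (p ^ k * (X ^ 2 - 1)) = 0 := by
    simp only [map_mul, map_sub, map_one, mk_X, map_pow (mk (p ^ (k + 1))) X]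
    linear_combination root (p ^ (k + 1)) * (h2 - r * h1) + mk (p ^ (k + 1)) (p ^ k) * hr
  rw [mk_eq_zero, pow_succ, mul_dvd_mul_iff_left (pow_ne_zero _ hirr.ne_zero),
    show (X ^ 2 - 1 : F[X]) = (X - C 1) * (X - C (-1)) by simp; ring] at h3
  have h4 : ∃ e : F, e * e = 1 ∧ p = X - C e := by
    rcases hirr.prime.dvd_or_dvd h3 with h | h
    · exact ⟨1, by simp, eq_of_monic_of_associated hp (monic_X_sub_C _)
        (hirr.associated_of_dvd (irreducible_X_sub_C _) h)⟩
    · exact ⟨-1, by simp, eq_of_monic_of_associated hp (monic_X_sub_C _)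
        (hirr.associated_of_dvd (irreducible_X_sub_C _) h)⟩
  obtain ⟨e, he, hpe⟩ := h4
  have hdeg : (p ^ (k + 1)).natDegree = k + 1 := by
    rw [natDegree_pow, hpe, natDegree_X_sub_C, mul_one]
  have hek : e = (-1) ^ k := by
    have hee : e ≠ (-1) ^ (k + 1) := by
      rintro rfl
      apply hne
      rw [hdeg]
      conv_lhs => rw [hpe]
      rw [pow_succ _ (k + 1), mul_neg_one, map_neg, sub_eq_add_neg]
    rcases mul_self_eq_one_iff.1 he with rfl | rfl <;>
      rcases neg_one_pow_eq_or F k with hk | hk <;> simp_all [pow_succ]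
  have he' : algebraMap F (AdjoinRoot (p ^ (k + 1))) e * algebraMap F _ e = 1 := by
    rw [← map_mul, he, map_one]
  obtain ⟨hrw, hs⟩ := inv_sub_pow_eq hr he' (root_sub_pow_succ_eq_zero (k := k) hpe)
  have hw0 := root_sub_pow_ne_zero (k := k) hirr hpe
  rw [mk_pow_eq_root_sub_pow hpe, map_pow, map_sub, hσ, AlgHom.commutes, hs] at h1
  apply hw0
  have hee : algebraMap F (AdjoinRoot (p ^ (k + 1))) e = (-1) ^ k := by rw [hek]; simp
  have h5 : (2 : F) • (root (p ^ (k + 1)) - algebraMap F _ e) ^ k = 0 := by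
    rw [Algebra.smul_def, map_ofNat]
    rw [← hee] at h1
    linear_combination h1 - algebraMap F (AdjoinRoot (p ^ (k + 1))) e * hrw -
      (root (p ^ (k + 1)) - algebraMap F _ e) ^ k * he'
  exact (smul_eq_zero.1 h5).resolve_left hchar

theorem exists_bilinForm_of_conditions (hchar : (2 : F) ≠ 0) {p : F[X]} (hp : p.Monic)
    (hirr : Irreducible p) {k : ℕ} (hX : p ≠ X)
    (hne : p ≠ X + C ((-1 : F) ^ ((p ^ (k + 1)).natDegree + 1)))
    (hrev : p = C (p.coeff 0)⁻¹ * p.reverse) :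
    ∃ B : LinearMap.BilinForm F (AdjoinRoot (p ^ (k + 1))),
      B.Nondegenerate ∧ ∀ u v, B u v = B (root (p ^ (k + 1)) * v) u := by
  have hc := coeff_zero_ne_zero_of_irreducible hp hirr hX
  obtain ⟨r, hr⟩ := exists_root_mul_eq_one (q := p ^ (k + 1)) (by
    rw [coeff_zero_eq_eval_zero, eval_pow, ← coeff_zero_eq_eval_zero]; exact pow_ne_zero _ hc)
  have hr0 : aeval r (p ^ (k + 1)) = 0 := by
    rw [map_pow, aeval_inv_root_of_eq_reverse hr hc hrev, mul_pow, ← map_pow (aeval _), aeval_eq,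
      mk_self, mul_zero]
  let σ : AdjoinRoot (p ^ (k + 1)) →ₐ[F] AdjoinRoot (p ^ (k + 1)) :=
    liftAlgHom (p ^ (k + 1)) (Algebra.ofId F _) r hr0
  have hσ : σ (root (p ^ (k + 1))) = r := liftAlgHom_root _ _ _ _
  have hσr : σ r = root (p ^ (k + 1)) := by
    have h := congrArg σ hr
    rw [map_mul, map_one, hσ] at h
    linear_combination root (p ^ (k + 1)) * h - σ r * hr
  have hσσ (w) : σ (σ w) = w := by
    have h : σ.comp σ = AlgHom.id F _ := algHom_ext (by simp [hσ, hσr])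
    exact DFunLike.congr_fun h w
  obtain ⟨g, hg⟩ := exists_add_inv_mul_ne_zero hchar hp hirr hne hr σ hσ
  obtain ⟨μ, hμ⟩ := Module.Projective.exists_dual_ne_zero F hg
  let τ : AdjoinRoot (p ^ (k + 1)) →ₗ[F] AdjoinRoot (p ^ (k + 1)) :=
    LinearMap.mulLeft F r ∘ₗ σ.toLinearMap
  let φ : AdjoinRoot (p ^ (k + 1)) →ₗ[F] F := μ + μ ∘ₗ τ
  have hφ (w) : φ w = μ (w + r * σ w) := by simp [φ, τ]
  have hφτ (w) : φ (r * σ w) = φ w := by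
    rw [hφ, hφ]
    congr 1
    rw [map_mul, hσσ, hσr]
    linear_combination w * hr
  have hdual (w) (hw : w ≠ 0) : ∃ h, φ (h * w) ≠ 0 := by
    obtain ⟨h, hh⟩ := exists_mul_eq_pow_of_ne_zero hirr hw
    refine ⟨h * g, ?_⟩
    rwa [mul_right_comm, hh, hφ]
  let B : LinearMap.BilinForm F (AdjoinRoot (p ^ (k + 1))) :=
    (LinearMap.mul F _).compr₂ φ ∘ₗ σ.toLinearMap
  have hB (u v) : B u v = φ (σ u * v) := rfl
  have hsymm (u v) : B u v = B (root (p ^ (k + 1)) * v) u := by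
    rw [hB, hB, ← hφτ, map_mul σ, map_mul σ, hσσ, hσ]
    congr 1
    ring
  have hright (v) (hv : ∀ u, B u v = 0) : v = 0 := by
    by_contra hv0
    obtain ⟨h, hh⟩ := hdual v hv0
    refine hh ?_
    rw [← hv (σ h), hB, hσσ]
  refine ⟨B, ⟨fun u hu => ?_, hright⟩, hsymm⟩
  refine hright u fun v => ?_
  rw [← hu (r * v), hsymm u, ← mul_assoc, hr, one_mul]

/-- the companion matrix of `p^l` (`p` monic irreducible, `l ≥ 1`) is a
cosquare iff `p ≠ x`, `p ≠ x + (-1)^(m+1)`, and `p = p^∨`, where `m = deg p^l`. -/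
theorem stmt_11 {F : Type*} [Field F] (hchar : (2 : F) ≠ 0) (p : Polynomial F)
    (hp : p.Monic) (hirr : Irreducible p) (l : ℕ) (hl : 1 ≤ l) :
    IsCosquare (companion (p ^ l)) ↔
      (p ≠ Polynomial.X ∧
       p ≠ Polynomial.X + Polynomial.C ((-1 : F) ^ ((p ^ l).natDegree + 1)) ∧
       p = Polynomial.C (p.coeff 0)⁻¹ * p.reverse) := by
  obtain ⟨k, rfl⟩ := Nat.exists_eq_add_of_le' hl
  rw [isCosquare_companion_iff_exists_bilinForm (hp.pow _)]
  constructor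
  · rintro ⟨B, hnd, hB⟩
    exact conditions_of_bilinForm hchar hp hirr hnd hB
  · rintro ⟨hX, hne, hrev⟩
    exact exists_bilinForm_of_conditions hchar hp hirr hX hne hrev
end

section
/- Let F be a field of characteristic different from 2. Every square matrix M over F is congruent to a block-diagonal direct sum of matrices, each of which is of one of the following three forms: (a) the skew sum [Φ ╲ I_m], where Φ is an m×m Frobenius block that is not a cosquare; (b) an invertible matrix Q such that Q^{-T}Q is similar to some Frobenius block; (c) the singular Jordan block J_s(0) with s odd. -/
open Matrix Polynomial

variable {F : Type*} [Field F]

/-- A canonical block for congruence over a general field of characteristic not 2: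
(a) `[Φ ╲ I_m]` with `Φ` an `m × m` Frobenius block that is not a cosquare;
(b) invertible `Q` with `Q⁻ᵀQ` similar to a Frobenius block;
(c) `J_s(0)` with `s` odd. -/
def GoodBlock13 {F : Type*} [Field F] {m : ℕ} (A : Matrix (Fin m) (Fin m) F) : Prop :=
  (∃ (r : ℕ) (h : r + r = m) (Φ : Matrix (Fin r) (Fin r) F),
      IsFrobeniusBlock Φ ∧ ¬ IsCosquare Φ ∧
      A = Matrix.reindex (finCongr h) (finCongr h) (skewSum Φ (1 : Matrix (Fin r) (Fin r) F))) ∨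
  (IsUnit A ∧ ∃ Φ : Matrix (Fin m) (Fin m) F, IsFrobeniusBlock Φ ∧ MatSimilar (A⁻¹ᵀ * A) Φ) ∨
  (Odd m ∧ A = jordanBlock m (0 : F))

section Rings

/-- In a finite-dimensional algebra, some polynomial in `a` is an idempotent that is trivial only
if `a` is nilpotent or invertible. -/
theorem exists_aeval_idempotent {T : Type*} [Ring T] [Algebra F T] [FiniteDimensional F T]
    (a : T) : ∃ p : F[X], aeval a p * aeval a p = aeval a p ∧
      (aeval a p = 0 → IsNilpotent a) ∧ (aeval a p = 1 → IsUnit a) := by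
  have h0 : minpoly F a ≠ 0 := minpoly.ne_zero (Algebra.IsIntegral.isIntegral a)
  obtain ⟨q, hq, hXq⟩ := Polynomial.exists_eq_pow_rootMultiplicity_mul_and_not_dvd
    (minpoly F a) h0 0
  set k := (minpoly F a).rootMultiplicity 0
  rw [C_0, sub_zero] at hq hXq
  have hcop : IsCoprime (X ^ k) q :=
    IsCoprime.pow_left ((Polynomial.irreducible_X.coprime_iff_not_dvd).2 hXq)
  obtain ⟨u, v, huv⟩ := hcop
  have hmin : aeval a (X ^ k * q) = 0 := by rw [← hq, minpoly.aeval]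
  have hsum : aeval a (u * X ^ k) + aeval a (v * q) = 1 := by
    rw [← map_add, huv, map_one]
  have hprod : aeval a (u * X ^ k) * aeval a (v * q) = 0 := by
    rw [← map_mul, show u * X ^ k * (v * q) = (u * v) * (X ^ k * q) by ring, map_mul, hmin,
      mul_zero]
  refine ⟨u * X ^ k, ?_, fun h => ⟨k, ?_⟩, fun h => ?_⟩
  · have := congrArg (aeval a (u * X ^ k) * ·) hsum
    simp only [mul_add, hprod, add_zero, mul_one] at this
    exact this
  · have h1 : aeval a (v * q) = 1 := by rw [← hsum, h, zero_add]
    have : aeval a (v * (X ^ k * q)) = 0 := by rw [map_mul, hmin, mul_zero]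
    rw [show v * (X ^ k * q) = X ^ k * (v * q) by ring, map_mul, h1, mul_one] at this
    simpa using this
  · rcases Nat.eq_zero_or_pos k with hk | hk
    · have hq' : aeval a q = 0 := by simpa [hk] using hmin
      have hcop : IsCoprime X q := (Polynomial.irreducible_X.coprime_iff_not_dvd).2 hXq
      obtain ⟨s, t, hst⟩ := hcop
      have : aeval a s * a = 1 := by
        have := congrArg (aeval a) hst
        simpa [hq'] using this
      have h' : a * aeval a s = 1 := by
        have := congrArg (aeval a) (mul_comm X s)
        simp only [map_mul, aeval_X] at this
        rw [this]; assumption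
      exact ⟨⟨a, aeval a s, h', this⟩, rfl⟩
    · have h1 : aeval a (u * X ^ (k - 1)) * a = 1 := by
        rw [← h]
        conv_rhs => rw [show k = k - 1 + 1 by omega]
        simp [pow_succ, mul_assoc]
      have h2 : a * aeval a (u * X ^ (k - 1)) = 1 := by
        have := congrArg (aeval a) (mul_comm X (u * X ^ (k - 1)))
        simp only [map_mul, aeval_X] at this h1 ⊢
        rw [this]; assumption
      exact ⟨⟨a, _, h2, h1⟩, rfl⟩

/-- An idempotent `e` with `e * star e` nilpotent can be deformed, in the same right ideal, to an
idempotent `f` with `f * star f = 0`. -/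
theorem exists_idempotent_mul_star_eq_zero {T : Type*} [Ring T] [Algebra F T] [StarRing T]
    (hs : ∀ (c : F) (x : T), star (c • x) = c • star x) (h2 : (2 : F) ≠ 0) (k : ℕ) :
    ∀ e : T, e * e = e → e ≠ 0 → (e * star e) ^ k = 0 →
      ∃ f : T, f * f = f ∧ f ≠ 0 ∧ f * star f = 0 := by
  obtain ⟨c, hc⟩ : ∃ c : F, c + c = 1 := ⟨2⁻¹, by rw [← two_mul, mul_inv_cancel₀ h2]⟩
  induction k using Nat.strong_induction_on with
  | _ k ih =>
    intro e he hne hk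
    have hse : star e * star e = star e := by rw [← star_mul, he]
    by_cases hk2 : k ≤ 1
    · refine ⟨e, he, hne, ?_⟩
      interval_cases k
      · have : (1 : T) = 0 := by simpa using hk
        rw [← mul_one (e * star e), this, mul_zero]
      · simpa using hk
    · set n := e * star e with hn
      have hen : e * n = n := by rw [hn, ← mul_assoc, he]
      have hne' : n * star e = n := by rw [hn, mul_assoc, hse]
      have hcn : star n = n := by simp [hn]
      set y := n * (1 - e) with hy
      have hye : y * e = 0 := by rw [hy, mul_assoc, sub_mul, he]; simp
      have hey : e * y = y := by rw [hy, ← mul_assoc, hen]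
      have hyy : y * y = 0 := by
        rw [hy, ← mul_assoc, mul_assoc n, sub_mul, hen]; simp
      have hsy : star y = (1 - star e) * n := by simp [hy, hcn]
      have h1 : e * star y = n - n * n := by
        rw [hsy, ← mul_assoc, mul_sub, ← hn, mul_one, sub_mul, hen]
      have h2 : y * star e = n - n * n := by
        rw [hy, mul_assoc, sub_mul, ← hn, one_mul, mul_sub, hne']
      have h3 : y * star y = n * n * n - n * n := by
        have h : (1 - e) * (1 - star e) = 1 - e - star e + n := by rw [hn]; noncomm_ring
        calc y * star y = n * ((1 - e) * (1 - star e)) * n := by rw [hsy, hy]; noncomm_ring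
          _ = n * n - n * (e * n) - (n * star e) * n + n * n * n := by rw [h]; noncomm_ring
          _ = _ := by rw [hen, hne']; noncomm_ring
      have hff : (e - c • y) * star (e - c • y) = n * n * (1 - (c * c) • 1 + (c * c) • n) := by
        rw [star_sub, hs]
        simp only [sub_mul, mul_sub, smul_mul_assoc, mul_smul_comm, h1, h2, h3, ← hn, mul_add,
          mul_one]
        match_scalars <;>
          first | linear_combination (-1 : F) * hc | linear_combination hc | ring
      refine ih ((k + 1) / 2) (by omega) (e - c • y) ?_ ?_ ?_
      · simp only [sub_mul, mul_sub, smul_mul_assoc, mul_smul_comm, he, hey, hye, hyy]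
        simp
      · intro h
        have := congrArg (· * e) h
        simp only [sub_mul, smul_mul_assoc, he, hye] at this
        exact hne (by simpa using this)
      · have hcomm : Commute (n * n) (1 - (c * c) • 1 + (c * c) • n) := by
          have : Commute n (1 - (c * c) • 1 + (c * c) • n) :=
            ((Commute.one_right n).sub_right ((Commute.one_right n).smul_right _)).add_right
              ((Commute.refl n).smul_right _)
          exact this.mul_left this
        rw [hff, hcomm.mul_pow, ← pow_two, ← pow_mul,
          pow_eq_zero_of_le (show k ≤ 2 * ((k + 1) / 2) by omega) hk, zero_mul]

/-- A finite-dimensional algebra with involution over a field of characteristic not two that has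
a nontrivial idempotent but no nontrivial self-adjoint one contains a hyperbolic idempotent. -/
theorem exists_hyperbolic_idempotent {T : Type*} [Ring T] [Algebra F T] [FiniteDimensional F T]
    [StarRing T] (hs : ∀ (c : F) (x : T), star (c • x) = c • star x) (h2 : (2 : F) ≠ 0)
    (hind : ∀ e : T, e * e = e → star e = e → e = 0 ∨ e = 1)
    (e : T) (he : e * e = e) (h0 : e ≠ 0) (h1 : e ≠ 1) :
    ∃ f : T, f * f = f ∧ f + star f = 1 := by
  have hpoly : ∀ (a : T), star a = a → ∀ p : F[X], star (aeval a p) = aeval a p := by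
    intro a ha p
    induction p using Polynomial.induction_on' with
    | add p q hp hq => rw [map_add, star_add, hp, hq]
    | monomial n c => rw [← C_mul_X_pow_eq_monomial, ← smul_eq_C_mul, map_smul, hs]; simp [ha]
  obtain ⟨p, hp, hnil, hunit⟩ := exists_aeval_idempotent (F := F) (e * star e)
  have hn : IsNilpotent (e * star e) := by
    rcases hind _ hp (hpoly _ (by simp) p) with h | h
    · exact hnil h
    · exfalso
      refine h1 ?_
      have h3 : (1 - e) * (e * star e) = 0 := by
        rw [← mul_assoc, sub_mul, he]; simp
      exact (sub_eq_zero.1 ((hunit h).mul_left_eq_zero.1 h3)).symm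
  obtain ⟨k, hk⟩ := hn
  obtain ⟨f, hf, hf0, hff⟩ := exists_idempotent_mul_star_eq_zero hs h2 k e he h0 hk
  obtain ⟨c, hc⟩ : ∃ c : F, c + c = 1 := ⟨2⁻¹, by rw [← two_mul, mul_inv_cancel₀ h2]⟩
  have hsf : star f * star f = star f := by rw [← star_mul, hf]
  set y := star f * f with hy
  have hsy : star y = y := by simp [hy]
  have hfy : f * y = 0 := by rw [hy, ← mul_assoc, hff, zero_mul]
  have hyf : y * f = y := by rw [hy, mul_assoc, hf]
  have hys : y * star f = 0 := by rw [hy, mul_assoc, hff, mul_zero]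
  have hsfy : star f * y = y := by rw [hy, ← mul_assoc, hsf]
  have hyy : y * y = 0 := by
    nth_rewrite 2 [hy]
    rw [← mul_assoc, hys, zero_mul]
  have hg : (f - c • y) * (f - c • y) = f - c • y := by
    simp only [sub_mul, mul_sub, smul_mul_assoc, mul_smul_comm, hf, hfy, hyf, hyy]
    simp
  have hg0 : f - c • y ≠ 0 := by
    intro h
    have := congrArg (f * ·) h
    simp only [mul_sub, mul_smul_comm, hf, hfy] at this
    exact hf0 (by simpa using this)
  have hgs : (f - c • y) * star (f - c • y) = 0 := by
    rw [star_sub, hs, hsy]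
    simp only [sub_mul, mul_sub, smul_mul_assoc, mul_smul_comm, hff, hfy, hys, hyy]
    simp
  have hsg : star (f - c • y) * (f - c • y) = 0 := by
    rw [star_sub, hs, hsy]
    simp only [sub_mul, mul_sub, smul_mul_assoc, mul_smul_comm, ← hy, hyf, hsfy, hyy]
    match_scalars; linear_combination (-1 : F) * hc
  set g := f - c • y
  have hsg' : star g * star g = star g := by rw [← star_mul, hg]
  refine ⟨g, hg, (hind (g + star g) ?_ ?_).resolve_left fun h => hg0 ?_⟩
  · simp only [mul_add, add_mul, hg, hgs, hsg, hsg', add_zero, zero_add]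
  · simp [add_comm]
  · have := congrArg (g * ·) h
    simpa [mul_add, hg, hgs] using this

end Rings

section Pencils

variable {U W : Type*} [AddCommGroup U] [Module F U] [AddCommGroup W] [Module F W]

/-- `(P, Q)` is an endomorphism of the pair of bilinear maps `α, γ : U × W → F`. -/
def IsPencilEnd (α γ : U →ₗ[F] W →ₗ[F] F) (P : Module.End F U) (Q : Module.End F W) : Prop :=
  (∀ u w, α (P u) w = α u (Q w)) ∧ ∀ u w, γ (P u) w = γ u (Q w)

/-- The pair of bilinear maps `α, γ : U × W → F` has no nontrivial idempotent endomorphism. -/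
def PencilIndec (α γ : U →ₗ[F] W →ₗ[F] F) : Prop :=
  ∀ P Q, IsPencilEnd α γ P Q → P * P = P → Q * Q = Q → (P = 0 ∧ Q = 0) ∨ (P = 1 ∧ Q = 1)

/-- The algebra of endomorphisms of a pair of bilinear maps. -/
def pencilAlg (α γ : U →ₗ[F] W →ₗ[F] F) :
    Subalgebra F (Module.End F U × (Module.End F W)ᵐᵒᵖ) where
  carrier := {x | IsPencilEnd α γ x.1 x.2.unop}
  mul_mem' := by
    rintro x y ⟨hx, hx'⟩ ⟨hy, hy'⟩
    constructor <;> intro u w <;> simp [hx, hx', hy, hy']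
  add_mem' := by
    rintro x y ⟨hx, hx'⟩ ⟨hy, hy'⟩
    constructor <;> intro u w <;> simp [hx, hx', hy, hy']
  algebraMap_mem' := by
    intro r
    constructor <;> intro u w <;> simp [Algebra.algebraMap_eq_smul_one]

theorem PencilIndec.symm {α γ : U →ₗ[F] W →ₗ[F] F} (h : PencilIndec α γ) : PencilIndec γ α :=
  fun P Q hPQ => h P Q hPQ.symm

theorem PencilIndec.flip {α γ : U →ₗ[F] W →ₗ[F] F} (h : PencilIndec α γ) :
    PencilIndec γ.flip α.flip :=
  fun P Q hPQ hP hQ => (h Q P ⟨fun u w => (hPQ.2 w u).symm, fun u w => (hPQ.1 w u).symm⟩ hQ hP).imp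
    And.symm And.symm

theorem PencilIndec.injective [FiniteDimensional F U] [FiniteDimensional F W]
    {α γ : U →ₗ[F] W →ₗ[F] F} (h : PencilIndec α γ) {P : Module.End F U} {Q : Module.End F W}
    (hPQ : IsPencilEnd α γ P Q) {v : U} (hv : v ≠ 0) (hPv : P v = v) :
    Function.Injective P ∧ Function.Injective Q := by
  have : FiniteDimensional F (Module.End F W)ᵐᵒᵖ :=
    Module.Finite.equiv (MulOpposite.opLinearEquiv F)
  let a : pencilAlg α γ := ⟨(P, MulOpposite.op Q), hPQ⟩
  obtain ⟨p, hp, hnil, hunit⟩ := exists_aeval_idempotent (F := F) a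
  set e := aeval a p
  have he1 : e.1.1 * e.1.1 = e.1.1 := congrArg (fun x => x.1.1) hp
  have he2 : e.1.2.unop * e.1.2.unop = e.1.2.unop := congrArg (fun x => x.1.2.unop) hp
  have hu : IsUnit a := by
    rcases h _ _ e.2 he1 he2 with h | h
    · exfalso
      obtain ⟨k, hk⟩ := hnil (Subtype.ext (Prod.ext h.1 (MulOpposite.unop_injective h.2)))
      have hk' : P ^ k = 0 := congrArg (fun x => x.1.1) hk
      have : ∀ j, (P ^ j) v = v := by
        intro j
        induction j with
        | zero => simp
        | succ j ih => rw [pow_succ, Module.End.mul_apply, hPv, ih]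
      exact hv (by rw [← this k, hk']; rfl)
    · exact hunit (Subtype.ext (Prod.ext h.1 (MulOpposite.unop_injective h.2)))
  have hu' : IsUnit (P, MulOpposite.op Q) := hu.map (pencilAlg α γ).val
  have hP : IsUnit P := (Prod.isUnit_iff.1 hu').1
  have hQ : IsUnit Q := isUnit_op.1 (Prod.isUnit_iff.1 hu').2
  exact ⟨((Module.End.isUnit_iff _).1 hP).1, ((Module.End.isUnit_iff _).1 hQ).1⟩

/-- Either a chain `y` starting at `v` ends in `Y`, or there is a dual chain separating `v`
from `Y`. -/
theorem exists_chain_or_dual_chain [FiniteDimensional F W] (α γ : U →ₗ[F] W →ₗ[F] F) (v : U)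
    (m : ℕ) : ∀ Y : Submodule F U,
    (∃ y : ℕ → U, y 0 = v ∧ (∀ i < m, α (y (i + 1)) = γ (y i)) ∧ y m ∈ Y) ∨
    ∃ (ψ : ℕ → Module.Dual F U) (w : ℕ → W), ψ 0 v = 1 ∧
      (∀ i < m, ∀ u, γ u (w i) = ψ i u) ∧ (∀ i < m, ∀ u, α u (w i) = ψ (i + 1) u) ∧
      ∀ u ∈ Y, ψ m u = 0 := by
  induction m with
  | zero =>
    intro Y
    by_cases hv : v ∈ Y
    · exact Or.inl ⟨fun _ => v, rfl, by simp, hv⟩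
    · obtain ⟨f, hf, hY⟩ := Submodule.exists_le_ker_of_notMem hv
      refine Or.inr ⟨fun _ => (f v)⁻¹ • f, fun _ => 0, ?_, by simp, by simp, ?_⟩
      · simp [hf]
      · intro u hu
        simp [LinearMap.mem_ker.1 (hY hu)]
  | succ m ih =>
    intro Y
    rcases ih ((Y.map α).comap γ) with ⟨y, h0, hy, z, hz, hzy⟩ | ⟨ψ, w, h0, hγ, hα, hψ⟩
    · refine Or.inl ⟨Function.update y (m + 1) z, ?_, ?_, ?_⟩
      · rw [Function.update_of_ne (by omega), h0]
      · intro i hi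
        rw [Function.update_of_ne (show i ≠ m + 1 by omega)]
        rcases Nat.lt_succ_iff_lt_or_eq.1 hi with h | rfl
        · rw [Function.update_of_ne (by omega), hy i h]
        · rw [Function.update_self, hzy]
      · simpa using hz
    · let T : (U × Y) →ₗ[F] Module.Dual F W := γ.coprod (-(α.comp Y.subtype))
      let f : Module.Dual F (U × Y) := (ψ m).comp (LinearMap.fst F U Y)
      have hf : f ∈ T.dualMap.range := by
        rw [LinearMap.range_dualMap_eq_dualAnnihilator_ker, Submodule.mem_dualAnnihilator]
        rintro ⟨u, y⟩ huy
        have : γ u - α y = 0 := by simpa [T, sub_eq_add_neg] using huy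
        exact hψ u ⟨y, y.2, (sub_eq_zero.1 this).symm⟩
      obtain ⟨g, hg⟩ := hf
      set x := (Module.evalEquiv F W).symm g
      have hx : ∀ φ : Module.Dual F W, g φ = φ x := fun φ => by simp [x]
      have hxf : ∀ u y, γ u x - α (y : Y) x = ψ m u := by
        intro u y
        have := LinearMap.congr_fun hg (u, y)
        simpa [T, f, hx, sub_eq_add_neg] using this
      have hlt : ∀ i < m + 1, i ≠ m → i < m := fun i h1 h2 => by omega
      refine Or.inr ⟨Function.update ψ (m + 1) (α.flip x), Function.update w m x, ?_, ?_, ?_, ?_⟩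
      · rw [Function.update_of_ne (by omega), h0]
      · intro i hi u
        rw [Function.update_of_ne (show i ≠ m + 1 by omega)]
        by_cases him : i = m
        · subst him
          simpa using hxf u 0
        · rw [Function.update_of_ne him, hγ i (hlt i hi him)]
      · intro i hi u
        by_cases him : i = m
        · subst him
          simp
        · rw [Function.update_of_ne him, Function.update_of_ne (by omega),
            hα i (hlt i hi him)]
      · intro u hu
        have := hxf 0 ⟨u, hu⟩
        simpa using this

/-- A chain and a dual chain define an endomorphism of the pencil. -/
theorem isPencilEnd_of_chains {α γ : U →ₗ[F] W →ₗ[F] F} {m : ℕ} {v : ℕ → U}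
    {ψ : ℕ → Module.Dual F U} {w : ℕ → W} (h0 : α (v 0) = 0)
    (hγ : ∀ i < m, ∀ u, γ u (w i) = ψ i u) (hα : ∀ i < m, ∀ u, α u (w i) = ψ (i + 1) u)
    (hv : ∀ i < m, ψ (i + 1) = 0 ∨ α (v (i + 1)) = γ (v i)) (hm : ψ m = 0 ∨ γ (v m) = 0) :
    IsPencilEnd α γ (∑ i ∈ Finset.range (m + 1), (ψ i).smulRight (v i))
      (∑ i ∈ Finset.range m, (γ (v i)).smulRight (w i)) := by
  constructor <;> intro u x
  · simp only [LinearMap.sum_apply, map_sum, LinearMap.smulRight_apply, map_smul,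
      LinearMap.smul_apply, smul_eq_mul]
    rw [Finset.sum_range_succ', h0, LinearMap.zero_apply, mul_zero, add_zero]
    refine Finset.sum_congr rfl fun i hi => ?_
    rw [hα i (Finset.mem_range.1 hi)]
    rcases hv i (Finset.mem_range.1 hi) with h | h <;> simp [h, mul_comm]
  · simp only [LinearMap.sum_apply, map_sum, LinearMap.smulRight_apply, map_smul,
      LinearMap.smul_apply, smul_eq_mul]
    rw [Finset.sum_range_succ]
    have : ψ m u * γ (v m) x = 0 := by rcases hm with h | h <;> simp [h]
    rw [this, add_zero]
    refine Finset.sum_congr rfl fun i hi => ?_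
    rw [hγ i (Finset.mem_range.1 hi), mul_comm]

/-- If arbitrarily long chains start at `v`, then some chain terminates. -/
theorem exists_singular_chain [FiniteDimensional F U] {α γ : U →ₗ[F] W →ₗ[F] F} {v : U}
    (hv : v ≠ 0) (hα : α v = 0)
    (h : ∀ m, ∃ y : ℕ → U, y 0 = v ∧ ∀ i < m, α (y (i + 1)) = γ (y i)) :
    ∃ (k : ℕ) (y : ℕ → U), y 0 ≠ 0 ∧ α (y 0) = 0 ∧ (∀ i < k, α (y (i + 1)) = γ (y i)) ∧
      γ (y k) = 0 := by
  obtain ⟨n, hn⟩ : ∃ n, Module.finrank F U = n := ⟨_, rfl⟩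
  obtain ⟨y, hy0, hy⟩ := h n
  obtain ⟨c, hc, i, hi⟩ : ∃ c : Fin (n + 1) → F, ∑ i, c i • y i = 0 ∧
      ∃ i, c i ≠ 0 := by
    refine Fintype.not_linearIndependent_iff.1 fun hli => ?_
    have := hli.fintype_card_le_finrank
    simp [hn] at this
  classical
  let c' : ℕ → F := fun j => if hj : j < n + 1 then c ⟨j, hj⟩ else 0
  have hc' : ∀ j : Fin (n + 1), c' j = c j := fun j => dif_pos j.2
  have hci : c' i ≠ 0 := by rwa [hc']
  set k := Nat.findGreatest (fun j => c' j ≠ 0) n with hk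
  have hck : c' k ≠ 0 := Nat.findGreatest_spec (P := fun j => c' j ≠ 0)
    (Nat.lt_succ_iff.1 i.2) hci
  have hkn : k ≤ n := Nat.findGreatest_le n
  have hkmax : ∀ j, k < j → c' j = 0 := by
    intro j hj
    by_cases hjn : j ≤ n
    · simpa using Nat.findGreatest_is_greatest (P := fun j => c' j ≠ 0) hj hjn
    · exact dif_neg (by omega)
  have hsum : ∑ j ∈ Finset.range (k + 1), c' j • y j = 0 := by
    rw [Finset.sum_subset (Finset.range_mono (show k + 1 ≤ n + 1 by omega))]
    · rw [Finset.sum_range, ← hc]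
      exact Finset.sum_congr rfl fun j _ => by rw [hc']
    · intro j _ hj
      rw [hkmax j (by simpa using hj), zero_smul]
  have hk0 : k ≠ 0 := by
    intro h0
    rw [h0] at hsum hck
    simp only [zero_add, Finset.sum_range_one, hy0] at hsum
    exact (smul_ne_zero hck hv) hsum
  let z : ℕ → U := fun j => ∑ i ∈ Finset.range (j + 1), c' (k - j + i) • y i
  have hz : ∀ j < k, α (z (j + 1)) = γ (z j) := by
    intro j hj
    simp only [z, map_sum, map_smul]
    rw [Finset.sum_range_succ', hy0, hα, smul_zero, add_zero]
    refine Finset.sum_congr rfl fun i hi => ?_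
    rw [hy i (by simp at hi; omega), show k - (j + 1) + (i + 1) = k - j + i by omega]
  refine ⟨k - 1, z, ?_, ?_, fun i hi => hz i (by omega), ?_⟩
  · simpa [z, hy0] using ⟨hck, hv⟩
  · simp [z, hy0, hα]
  · rw [← hz _ (by omega), show k - 1 + 1 = k by omega]
    simp [z, hsum]

/-- The pair of bilinear maps `α, γ` is, in suitable bases, the singular Kronecker pencil with
`m + 1` columns and `m` rows. -/
def IsSingularPencil (α γ : U →ₗ[F] W →ₗ[F] F) : Prop :=
  ∃ (m : ℕ) (u : Module.Basis (Fin (m + 1)) F U) (w : Module.Basis (Fin m) F W),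
    (∀ i j, α (u i) (w j) = if (i : ℕ) = j + 1 then 1 else 0) ∧
    ∀ i j, γ (u i) (w j) = if (i : ℕ) = j then 1 else 0

theorem IsSingularPencil.symm {α γ : U →ₗ[F] W →ₗ[F] F} (h : IsSingularPencil α γ) :
    IsSingularPencil γ α := by
  obtain ⟨m, u, w, hα, hγ⟩ := h
  refine ⟨m, u.reindex Fin.revPerm, w.reindex Fin.revPerm, fun i j => ?_, fun i j => ?_⟩
  · simp only [Module.Basis.reindex_apply, Fin.revPerm_symm, Fin.revPerm_apply, hγ, Fin.val_rev]
    congr 1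
    simp only [eq_iff_iff]
    omega
  · simp only [Module.Basis.reindex_apply, Fin.revPerm_symm, Fin.revPerm_apply, hα, Fin.val_rev]
    congr 1
    simp only [eq_iff_iff]
    omega

theorem isSingularPencil_of_chain [FiniteDimensional F U] [FiniteDimensional F W]
    {α γ : U →ₗ[F] W →ₗ[F] F} (h : PencilIndec α γ)
    (hex : ∃ (k : ℕ) (y : ℕ → U), y 0 ≠ 0 ∧ α (y 0) = 0 ∧
      (∀ i < k, α (y (i + 1)) = γ (y i)) ∧ γ (y k) = 0) :
    IsSingularPencil α γ := by
  classical
  obtain ⟨v, hv0, hαv, hv, hγv⟩ := Nat.find_spec hex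
  set m := Nat.find hex with hm
  rcases exists_chain_or_dual_chain α γ (v 0) m ⊥ with ⟨y, hy0, hy, hym⟩ | ⟨ψ, w, h0, hγ, hα, -⟩
  · exfalso
    rw [Submodule.mem_bot] at hym
    have hm0 : m ≠ 0 := by
      intro hm0
      rw [hm0, hy0] at hym
      exact hv0 hym
    refine Nat.find_min hex (m := m - 1) (by omega) ⟨y, hy0 ▸ hv0, hy0 ▸ hαv,
      fun i hi => hy i (by omega), ?_⟩
    rw [← hy _ (by omega), show m - 1 + 1 = m by omega, hym, map_zero]
  · have hend := isPencilEnd_of_chains hαv hγ hα (fun i hi => Or.inr (hv i hi)) (Or.inr hγv)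
    have hzero : ∀ k < m, ψ (k + 1) (v 0) = 0 := fun k hk => by rw [← hα k hk, hαv]; rfl
    have hsucc : ∀ k < m, ∀ i < m, ψ (k + 1) (v (i + 1)) = ψ k (v i) := fun k hk i hi => by
      rw [← hα k hk, hv i hi, hγ k hk]
    have hlast : ∀ k < m, ψ k (v m) = 0 := fun k hk => by rw [← hγ k hk, hγv]; rfl
    have hdiag : ∀ i ≤ m, ψ i (v i) = 1 := by
      intro i
      induction i with
      | zero => exact fun _ => h0
      | succ i ih => exact fun hi => by rw [hsucc i hi i hi, ih (by omega)]
    have hlow : ∀ i k, i < k → k ≤ m → ψ k (v i) = 0 := by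
      intro i
      induction i with
      | zero =>
        intro k hk hkm
        obtain ⟨k, rfl⟩ := Nat.exists_eq_succ_of_ne_zero hk.ne'
        exact hzero k hkm
      | succ i ih =>
        intro k hk hkm
        obtain ⟨k, rfl⟩ := Nat.exists_eq_succ_of_ne_zero (by omega : k ≠ 0)
        rw [Nat.succ_eq_add_one, hsucc k hkm i (by omega), ih k (by omega) (by omega)]
    have hupp : ∀ d i k, i + d = m → k < i → ψ k (v i) = 0 := by
      intro d
      induction d with
      | zero => rintro i k rfl hk; exact hlast k hk
      | succ d ih =>
        intro i k hi hk
        rw [← hsucc k (by omega) i (by omega), ih (i + 1) (k + 1) (by omega) (by omega)]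
    have hδ : ∀ i ≤ m, ∀ k ≤ m, ψ k (v i) = if i = k then 1 else 0 := by
      intro i hi k hk
      rcases lt_trichotomy i k with h | h | h
      · rw [if_neg h.ne, hlow i k h hk]
      · rw [if_pos h, h, hdiag k hk]
      · rw [if_neg h.ne', hupp (m - i) i k (by omega) h]
    have hPv : (∑ i ∈ Finset.range (m + 1), (ψ i).smulRight (v i)) (v 0) = v 0 := by
      rw [LinearMap.sum_apply, Finset.sum_eq_single 0]
      · simp [h0]
      · intro k hk hk0
        rw [LinearMap.smulRight_apply, hδ 0 (by omega) k (by simp at hk; omega), if_neg hk0.symm,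
          zero_smul]
      · simp
    obtain ⟨hP, hQ⟩ := h.injective hend hv0 hPv
    have hU : Module.DualBases (fun i : Fin (m + 1) => v i) (fun i : Fin (m + 1) => ψ i) :=
      { eval_same := fun i => hdiag i (by omega)
        eval_of_ne := fun i j hij => by
          beta_reduce
          rw [hδ j (by omega) i (by omega), if_neg (fun h => hij (Fin.ext h.symm))]
        total := fun {x y} hxy => hP (by
          rw [LinearMap.sum_apply, LinearMap.sum_apply]
          exact Finset.sum_congr rfl fun i hi => by
            rw [LinearMap.smulRight_apply, LinearMap.smulRight_apply,
              hxy ⟨i, by simpa using hi⟩]) }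
    have hW : Module.DualBases (fun i : Fin m => w i) (fun i : Fin m => γ (v i)) :=
      { eval_same := fun i => by rw [hγ i i.2, hdiag i (by omega)]
        eval_of_ne := fun i j hij => by
          beta_reduce
          rw [hγ j j.2, hδ i (by omega) j (by omega), if_neg (fun h => hij (Fin.ext h))]
        total := fun {x y} hxy => hQ (by
          rw [LinearMap.sum_apply, LinearMap.sum_apply]
          exact Finset.sum_congr rfl fun i hi => by
            rw [LinearMap.smulRight_apply, LinearMap.smulRight_apply,
              hxy ⟨i, by simpa using hi⟩]) }
    refine ⟨m, hU.basis, hW.basis, fun i j => ?_, fun i j => ?_⟩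
    · simp only [Module.DualBases.coe_basis]
      rw [hα j j.2, hδ i (by omega) _ (by omega)]
    · simp only [Module.DualBases.coe_basis]
      rw [hγ j j.2, hδ i (by omega) _ (by omega)]

/-- Kronecker's classification: an indecomposable pencil `α, γ` with `α` degenerate on the left
is either singular or has `γ` nondegenerate. -/
theorem PencilIndec.singular_or_nondegenerate [FiniteDimensional F U] [FiniteDimensional F W]
    {α γ : U →ₗ[F] W →ₗ[F] F} (h : PencilIndec α γ) {v : U} (hv : v ≠ 0) (hαv : α v = 0) :
    IsSingularPencil α γ ∨ (Function.Injective γ ∧ Function.Injective γ.flip) := by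
  classical
  by_cases hch : ∀ m, ∃ y : ℕ → U, y 0 = v ∧ ∀ i < m, α (y (i + 1)) = γ (y i)
  · exact Or.inl (isSingularPencil_of_chain h (exists_singular_chain hv hαv hch))
  right
  push Not at hch
  set m := Nat.find hch with hm
  have hspec := Nat.find_spec hch
  have hm0 : m ≠ 0 := fun h0 => by
    obtain ⟨i, hi, -⟩ := hspec (fun _ => v) rfl
    omega
  obtain ⟨y, hy0, hy⟩ : ∃ y : ℕ → U, y 0 = v ∧ ∀ i < m - 1, α (y (i + 1)) = γ (y i) := by
    have := Nat.find_min hch (m := m - 1) (by omega)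
    push Not at this
    exact this
  rcases exists_chain_or_dual_chain α γ v m ⊤ with ⟨z, hz0, hz, -⟩ | ⟨ψ, w, h0, hγ, hα, hψ⟩
  · obtain ⟨i, hi, hne⟩ := hspec z hz0
    exact absurd (hz i hi) hne
  have hψm : ψ m = 0 := LinearMap.ext fun u => hψ u trivial
  have hend := isPencilEnd_of_chains (v := y) (by rw [hy0, hαv]) hγ hα
    (fun i hi => by
      rcases Nat.lt_or_ge i (m - 1) with h | h
      · exact Or.inr (hy i h)
      · exact Or.inl (by rw [show i + 1 = m by omega, hψm]))
    (Or.inl hψm)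
  have hPv : (∑ i ∈ Finset.range (m + 1), (ψ i).smulRight (y i)) v = v := by
    rw [LinearMap.sum_apply, Finset.sum_eq_single 0]
    · simp [h0, hy0]
    · intro k hk hk0
      obtain ⟨k, rfl⟩ := Nat.exists_eq_succ_of_ne_zero hk0
      rw [LinearMap.smulRight_apply, Nat.succ_eq_add_one, ← hα k (by simp at hk; omega), hαv]
      simp
    · simp
  obtain ⟨hP, hQ⟩ := h.injective hend hv hPv
  constructor
  · rw [injective_iff_map_eq_zero]
    intro u hu
    refine hP ?_
    rw [map_zero, LinearMap.sum_apply]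
    refine Finset.sum_eq_zero fun i hi => ?_
    rcases Nat.lt_succ_iff_lt_or_eq.1 (Finset.mem_range.1 hi) with h | rfl
    · rw [LinearMap.smulRight_apply, ← hγ i h, hu]
      simp
    · simp [hψm]
  · rw [injective_iff_map_eq_zero]
    intro x hx
    refine hQ ?_
    rw [map_zero, LinearMap.sum_apply]
    refine Finset.sum_eq_zero fun i _ => ?_
    rw [LinearMap.smulRight_apply, ← LinearMap.flip_apply, hx]
    simp

end Pencils

section Cyclic

variable {V : Type*} [AddCommGroup V] [Module F V]

/-- A linear endomorphism that commutes with no nontrivial idempotent is cyclic, and the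
annihilator of a generator is spanned by a power of an irreducible polynomial. -/
theorem exists_cyclic_vector [FiniteDimensional F V] [Nontrivial V] (f : Module.End F V)
    (hf : ∀ S : Module.End F V, S * f = f * S → S * S = S → S = 0 ∨ S = 1) :
    ∃ (p : F[X]) (l : ℕ) (v : V), p.Monic ∧ Irreducible p ∧ 1 ≤ l ∧
      (∀ q : F[X], aeval f q v = 0 ↔ p ^ l ∣ q) ∧ ∀ x, ∃ q : F[X], aeval f q v = x := by
  classical
  obtain ⟨ι, _, p, hp, e, ⟨ψ⟩⟩ := Module.equiv_directSum_of_isTorsion (R := F[X])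
    (M := Module.AEval' f) (Module.AEval.isTorsion_of_finiteDimensional F V f)
  obtain ⟨x, hx⟩ := exists_ne (0 : V)
  obtain ⟨i, hi⟩ : ∃ i, ψ (Module.AEval'.of f x) i ≠ 0 := by
    by_contra! h
    exact hx (by simpa using (DFinsupp.ext h : ψ (Module.AEval'.of f x) = 0))
  let c := DirectSum.component F[X] ι _ i ∘ₗ ψ.toLinearMap
  let k := ψ.symm.toLinearMap ∘ₗ DirectSum.lof F[X] ι
    (fun i => F[X] ⧸ Submodule.span F[X] {p i ^ e i}) i
  have hck : ∀ y, c (k y) = y := fun y => by simp [c, k, DirectSum.component.lof_self]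
  let S : Module.End F V := (Module.AEval'.of f).symm.toLinearMap ∘ₗ
    ((k ∘ₗ c).restrictScalars F) ∘ₗ (Module.AEval'.of f).toLinearMap
  have hS : ∀ y, Module.AEval'.of f (S y) = k (c (Module.AEval'.of f y)) := fun y => by simp [S]
  have hSx : S ≠ 0 := fun h => hi <| by
    have := hS x
    rw [h, LinearMap.zero_apply, map_zero] at this
    have := congrArg c this
    rw [hck, map_zero] at this
    exact this.symm
  have hS1 : S = 1 := by
    refine (hf S ?_ ?_).resolve_left hSx <;> ext y <;> apply (Module.AEval'.of f).injective
    · simp only [Module.End.mul_apply, hS, ← Module.AEval'.X_smul_of, map_smul]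
    · simp only [Module.End.mul_apply, hS, hck]
  have hkc : ∀ y, k (c y) = y := fun y => by
    have := hS ((Module.AEval'.of f).symm y)
    rw [hS1] at this
    simpa using this.symm
  have hv : ∀ q : F[X], Module.AEval'.of f (aeval f q ((Module.AEval'.of f).symm
      (k (Submodule.Quotient.mk 1)))) = k (Submodule.Quotient.mk q) := fun q => by
    have := Module.AEval.of_aeval_smul f q ((Module.AEval'.of f).symm
      (k (Submodule.Quotient.mk 1)))
    rwa [LinearEquiv.apply_symm_apply, ← map_smul k, ← Submodule.Quotient.mk_smul, smul_eq_mul,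
      mul_one] at this
  have hass : Associated (normalize (p i) ^ e i) (p i ^ e i) := (normalize_associated _).pow_pow
  have hdvd : ∀ q : F[X], aeval f q ((Module.AEval'.of f).symm (k (Submodule.Quotient.mk 1))) = 0 ↔
      normalize (p i) ^ e i ∣ q := fun q => by
    rw [← (Module.AEval'.of f).map_eq_zero_iff, hv, hass.dvd_iff_dvd_left,
      ← Ideal.mem_span_singleton, ← Ideal.submodule_span_eq, ← Submodule.Quotient.mk_eq_zero]
    exact ⟨fun h => by simpa [hck] using congrArg c h, fun h => by rw [h, map_zero]⟩
  have hgen : ∀ y, ∃ q : F[X],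
      aeval f q ((Module.AEval'.of f).symm (k (Submodule.Quotient.mk 1))) = y := fun y => by
    obtain ⟨q, hq⟩ := Submodule.Quotient.mk_surjective _ (c (Module.AEval'.of f y))
    exact ⟨q, (Module.AEval'.of f).injective (by rw [hv, hq, hkc])⟩
  refine ⟨normalize (p i), e i, _, monic_normalize (hp i).ne_zero,
    (associated_normalize _).irreducible (hp i), ?_, hdvd, hgen⟩
  by_contra h
  obtain ⟨q, hq⟩ := hgen x
  refine hx (hq ▸ (hdvd q).2 ?_)
  simp [show e i = 0 by omega]

/-- A linear endomorphism that commutes with no nontrivial idempotent is represented by a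
Frobenius block in some basis. -/
theorem exists_basis_isFrobeniusBlock [FiniteDimensional F V] [Nontrivial V] (f : Module.End F V)
    (hf : ∀ S : Module.End F V, S * f = f * S → S * S = S → S = 0 ∨ S = 1) :
    ∃ (m : ℕ) (Φ : Matrix (Fin m) (Fin m) F) (b : Module.Basis (Fin m) F V),
      IsFrobeniusBlock Φ ∧ ∀ j, f (b j) = ∑ i, Φ i j • b i := by
  obtain ⟨p, l, v, hpm, hpi, hl, hdvd, hgen⟩ := exists_cyclic_vector f hf
  have hqm : (p ^ l).Monic := hpm.pow l
  have hcoe : ∀ c : Fin (p ^ l).natDegree → F, aeval f (∑ i, C (c i) * Polynomial.X ^ (i : ℕ)) v =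
      ∑ i, c i • (f ^ (i : ℕ)) v := fun c => by
    simp [map_sum, LinearMap.sum_apply, ← Algebra.smul_def]
  have hli : LinearIndependent F fun i : Fin (p ^ l).natDegree => (f ^ (i : ℕ)) v := by
    rw [Fintype.linearIndependent_iff]
    intro c hc i
    rw [← hcoe, hdvd] at hc
    have hdeg := degree_sum_fin_lt c
    have h0 := eq_zero_of_dvd_of_degree_lt hc (by rwa [degree_eq_natDegree hqm.ne_zero])
    have := congrArg (fun q => coeff q i) h0
    simpa [finsetSum_coeff, coeff_C_mul, coeff_X_pow, Fin.val_inj] using this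
  have hsp : ⊤ ≤ Submodule.span F (Set.range fun i : Fin (p ^ l).natDegree => (f ^ (i : ℕ)) v) := by
    rintro x -
    obtain ⟨q, rfl⟩ := hgen x
    have hmod : aeval f q v = aeval f (q %ₘ (p ^ l)) v := by
      conv_lhs => rw [← modByMonic_add_div q (p ^ l)]
      rw [map_add, LinearMap.add_apply, (hdvd (p ^ l * _)).2 (dvd_mul_right _ _), add_zero]
    have hlt : (q %ₘ (p ^ l)).natDegree < (p ^ l).natDegree :=
      natDegree_modByMonic_lt _ hqm fun h => by
        have := hpi.natDegree_pos
        have h' : (p ^ l).natDegree = 0 := by rw [h, natDegree_one]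
        rw [natDegree_pow] at h'
        rcases Nat.mul_eq_zero.1 h' with h | h <;> omega
    rw [hmod, aeval_eq_sum_range' hlt, Finset.sum_range, LinearMap.sum_apply]
    exact Submodule.sum_mem _ fun i _ => Submodule.smul_mem _ _ (Submodule.subset_span ⟨i, rfl⟩)
  refine ⟨_, companion (p ^ l), Module.Basis.mk hli hsp, ⟨p, l, hpm, hpi, hl, rfl, by simp⟩,
    fun j => ?_⟩
  simp only [Module.Basis.mk_apply, companion, of_apply]
  rw [← Module.End.mul_apply, ← pow_succ']
  have hj := j.2
  by_cases h : (j : ℕ) = (p ^ l).natDegree - 1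
  · simp only [if_pos h, neg_smul, Finset.sum_neg_distrib]
    have h0 := (hdvd (p ^ l)).2 dvd_rfl
    rw [aeval_eq_sum_range, Finset.sum_range_succ, hqm.coeff_natDegree, one_smul,
      Finset.sum_range, LinearMap.add_apply, LinearMap.sum_apply] at h0
    rw [show (j : ℕ) + 1 = (p ^ l).natDegree by omega]
    exact eq_neg_of_add_eq_zero_right h0
  · simp only [if_neg h, ite_smul, one_smul, zero_smul]
    rw [Finset.sum_eq_single ⟨j + 1, by omega⟩ (fun i _ hi => if_neg fun h' => hi (Fin.ext h'))
      (by simp)]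
    simp

variable {U W : Type*} [AddCommGroup U] [Module F U] [AddCommGroup W] [Module F W]

/-- An indecomposable pencil with a perfect member is given by a Frobenius block. -/
theorem PencilIndec.exists_basis_isFrobeniusBlock [FiniteDimensional F U] [FiniteDimensional F W]
    [Nontrivial U] {α γ : U →ₗ[F] W →ₗ[F] F} (h : PencilIndec α γ)
    [γ.IsPerfPair] :
    ∃ (m : ℕ) (Φ : Matrix (Fin m) (Fin m) F) (b : Module.Basis (Fin m) F U),
      IsFrobeniusBlock Φ ∧ ∀ j w, α (b j) w = ∑ i, Φ i j * γ (b i) w := by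
  let f : Module.End F U := γ.toPerfPair.symm.toLinearMap ∘ₗ α
  have hγf : ∀ u w, γ (f u) w = α u w := fun u w => by
    rw [← LinearMap.toLinearMap_toPerfPair]; simp [f]
  have hinj : Function.Injective γ.flip := (LinearMap.IsPerfPair.bijective_right γ).1
  obtain ⟨m, Φ, b, hΦ, hb⟩ := _root_.exists_basis_isFrobeniusBlock f fun S hS hS2 => by
    let Q : Module.End F W := γ.flip.toPerfPair.symm.toLinearMap ∘ₗ S.dualMap ∘ₗ γ.flip
    have hQ : ∀ u w, γ (S u) w = γ u (Q w) := fun u w => by simp [Q]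
    have hSQ : IsPencilEnd α γ S Q := ⟨fun u w => by
      rw [← hγf, ← hγf, ← hQ, ← Module.End.mul_apply, ← hS, Module.End.mul_apply], hQ⟩
    have hQ2 : Q * Q = Q := by
      ext w
      refine hinj (LinearMap.ext fun u => ?_)
      simp only [LinearMap.flip_apply, Module.End.mul_apply, ← hQ]
      rw [← Module.End.mul_apply, hS2]
    exact (h S Q hSQ hS2 hQ2).imp And.left And.left
  refine ⟨m, Φ, b, hΦ, fun j w => ?_⟩
  rw [← hγf, hb]
  simp
end Cyclic

section Forms

open Module

variable {V : Type*} [AddCommGroup V] [Module F V]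

/-- The bilinear form `B` has no nontrivial self-adjoint idempotent, that is, it is not an
orthogonal direct sum of two nonzero forms. -/
def FormIndec (B : V →ₗ[F] V →ₗ[F] F) : Prop :=
  ∀ S : End F V, (∀ x y, B (S x) y = B x (S y)) → S * S = S → S = 0 ∨ S = 1

/-- The matrix of the bilinear form `B` in some basis is a canonical block. -/
def HasBlockBasis (B : V →ₗ[F] V →ₗ[F] F) : Prop :=
  ∃ (m : ℕ) (b : Basis (Fin m) F V), GoodBlock13 (LinearMap.toMatrix₂ b b B)

/-- The pencil of an indecomposable form is regular. -/
theorem PencilIndec.injective_of_form [FiniteDimensional F V] {B C : V →ₗ[F] V →ₗ[F] F}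
    (h : PencilIndec B C) (hC : C = B.flip) : Function.Injective B := by
  rw [injective_iff_map_eq_zero]
  by_contra! ⟨v, hBv, hv⟩
  rcases h.singular_or_nondegenerate hv hBv with ⟨m, u, w, -⟩ | ⟨-, hinj⟩
  · have h1 := finrank_eq_card_basis u
    have h2 := finrank_eq_card_basis w
    simp only [Fintype.card_fin] at h1 h2
    omega
  · rw [hC, LinearMap.flip_flip] at hinj
    exact hv (hinj (by rw [hBv, map_zero]))

/-- A form that is indecomposable as a pencil is given by a matrix whose cosquare is similar to a
Frobenius block. -/
theorem PencilIndec.hasBlockBasis [FiniteDimensional F V] [Nontrivial V]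
    {B : V →ₗ[F] V →ₗ[F] F} (h : PencilIndec B B.flip) : HasBlockBasis B := by
  have hB : Function.Injective B := h.injective_of_form rfl
  have := LinearMap.IsPerfPair.of_injective hB (h.symm.injective_of_form (B.flip_flip).symm)
  obtain ⟨m, Φ, b, hΦ, hb⟩ := h.symm.exists_basis_isFrobeniusBlock
  have hA : LinearMap.toMatrix₂ b b B = (LinearMap.toMatrix₂ b b B)ᵀ * Φ := by
    ext i j
    simp only [mul_apply, transpose_apply, LinearMap.toMatrix₂_apply]
    rw [← LinearMap.flip_apply, hb]
    exact Finset.sum_congr rfl fun k _ => mul_comm _ _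
  have hdet : IsUnit (LinearMap.toMatrix₂ b b B).det :=
    ((LinearMap.separatingLeft_iff_det_ne_zero b).1
      (LinearMap.separatingLeft_iff_ker_eq_bot.2 (LinearMap.ker_eq_bot.2 hB))).isUnit
  refine ⟨m, b, Or.inr (Or.inl ⟨(isUnit_iff_isUnit_det _).2 hdet, Φ, hΦ, 1, isUnit_one, ?_⟩)⟩
  rw [inv_one, one_mul, mul_one]
  calc (LinearMap.toMatrix₂ b b B)⁻¹ᵀ * LinearMap.toMatrix₂ b b B
      = (LinearMap.toMatrix₂ b b B)⁻¹ᵀ * ((LinearMap.toMatrix₂ b b B)ᵀ * Φ) := congrArg _ hA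
    _ = Φ := by
      rw [← mul_assoc, ← transpose_mul, mul_nonsing_inv _ hdet, transpose_one, one_mul]

variable {U W : Type*} [AddCommGroup U] [Module F U] [AddCommGroup W] [Module F W]

/-- `E` is a decomposition of `V` into two totally isotropic subspaces, and the pencil `(α, γ)`
describes the form `B` with respect to it. -/
def IsHyperbolicPencil (B : V →ₗ[F] V →ₗ[F] F) (E : (U × W) ≃ₗ[F] V)
    (α γ : U →ₗ[F] W →ₗ[F] F) : Prop :=
  ∀ u w u' w', B (E (u, w)) (E (u', w')) = γ u w' + α u' w

theorem IsHyperbolicPencil.swap {B : V →ₗ[F] V →ₗ[F] F} {E : (U × W) ≃ₗ[F] V}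
    {α γ : U →ₗ[F] W →ₗ[F] F} (h : IsHyperbolicPencil B E α γ) :
    IsHyperbolicPencil B ((LinearEquiv.prodComm F W U).trans E) γ.flip α.flip := fun u w u' w' => by
  simp [h w u w' u', add_comm]

theorem FormIndec.eq_zero_or_one {B : V →ₗ[F] V →ₗ[F] F} (hB : FormIndec B) (E : (U × W) ≃ₗ[F] V)
    (S : End F (U × W)) (hS : ∀ x y, B (E (S x)) (E y) = B (E x) (E (S y))) (hS2 : S * S = S) :
    S = 0 ∨ S = 1 := by
  refine (hB (E.conj S) (fun x y => ?_) ?_).imp (fun h => ?_) fun h => ?_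
  · simpa [LinearEquiv.conj_apply_apply] using hS (E.symm x) (E.symm y)
  · conv_rhs => rw [← hS2]
    exact (E.conj_comp S S).symm
  · exact E.conj.injective (by rw [h, map_zero])
  · exact E.conj.injective (h.trans E.conj_id.symm)

theorem FormIndec.pencilIndec {B : V →ₗ[F] V →ₗ[F] F} (hB : FormIndec B) {E : (U × W) ≃ₗ[F] V}
    {α γ : U →ₗ[F] W →ₗ[F] F} (h : IsHyperbolicPencil B E α γ) : PencilIndec α γ := by
  rintro P Q ⟨hα, hγ⟩ hP hQ
  refine (hB.eq_zero_or_one E (P.prodMap Q) ?_ ?_).imp (fun h0 => ?_) fun h1 => ?_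
  · rintro ⟨u, w⟩ ⟨u', w'⟩
    simp only [LinearMap.prodMap_apply]
    rw [h, h, hα, hγ]
  · rw [LinearMap.prodMap_mul, hP, hQ]
  · constructor <;> ext x
    · simpa using congrArg Prod.fst (LinearMap.congr_fun h0 (x, 0))
    · simpa using congrArg Prod.snd (LinearMap.congr_fun h0 (0, x))
  · constructor <;> ext x
    · simpa using congrArg Prod.fst (LinearMap.congr_fun h1 (x, 0))
    · simpa using congrArg Prod.snd (LinearMap.congr_fun h1 (0, x))

/-- An indecomposable hyperbolic form has no symmetry exchanging the two isotropic subspaces. -/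
theorem FormIndec.not_symmetric [Nontrivial U] (h2 : (2 : F) ≠ 0) {B : V →ₗ[F] V →ₗ[F] F}
    (hB : FormIndec B) {E : (U × W) ≃ₗ[F] V} {α γ : U →ₗ[F] W →ₗ[F] F}
    (h : IsHyperbolicPencil B E α γ) (T : U ≃ₗ[F] W) (hT : ∀ u u', α u' (T u) = γ u (T u')) :
    False := by
  let S : End F (U × W) := (2 : F)⁻¹ • (1 + (T.symm.toLinearMap ∘ₗ LinearMap.snd F U W).prod
    (T.toLinearMap ∘ₗ LinearMap.fst F U W))
  have hS : ∀ u w, S (u, w) = ((2 : F)⁻¹ • (u + T.symm w), (2 : F)⁻¹ • (w + T u)) := fun u w => by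
    simp [S]
  obtain ⟨u, hu⟩ := exists_ne (0 : U)
  have hadj : ∀ x y, B (E (S x)) (E y) = B (E x) (E (S y)) := by
    rintro ⟨u, w⟩ ⟨u', w'⟩
    have h1 := hT u u'
    have h2 := hT (T.symm w) (T.symm w')
    simp only [LinearEquiv.apply_symm_apply] at h2
    rw [hS, hS, h, h]
    simp only [map_smul, map_add, LinearMap.smul_apply, LinearMap.add_apply, smul_eq_mul]
    linear_combination (2 : F)⁻¹ * (h1 - h2)
  have hidem : S * S = S := by
    refine LinearMap.ext fun ⟨u, w⟩ => ?_
    rw [Module.End.mul_apply, hS, hS]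
    simp only [map_smul, map_add, LinearEquiv.apply_symm_apply, LinearEquiv.symm_apply_apply,
      Prod.mk.injEq]
    have half : (2 : F)⁻¹ + 2⁻¹ = 1 := by rw [← two_mul, mul_inv_cancel₀ h2]
    constructor
    · linear_combination (norm := module) half • ((2 : F)⁻¹ • (u + T.symm w))
    · linear_combination (norm := module) half • ((2 : F)⁻¹ • (w + T u))
  rcases hB.eq_zero_or_one E S hadj hidem with h0 | h1
  · have := congrArg Prod.fst (LinearMap.congr_fun h0 (u, 0))
    rw [hS] at this
    simp [h2, hu] at this
  · have := congrArg Prod.snd (LinearMap.congr_fun h1 (u, 0))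
    rw [hS] at this
    simp [h2, hu] at this

theorem FormIndec.hasBlockBasis_of_isPerfPair [FiniteDimensional F U] [FiniteDimensional F W]
    [Nontrivial U] (h2 : (2 : F) ≠ 0) {B : V →ₗ[F] V →ₗ[F] F}
    (hB : FormIndec B) {E : (U × W) ≃ₗ[F] V} {α γ : U →ₗ[F] W →ₗ[F] F}
    (h : IsHyperbolicPencil B E α γ) [γ.IsPerfPair] : HasBlockBasis B := by
  obtain ⟨r, Φ, u, hΦ, hu⟩ := (hB.pencilIndec h).exists_basis_isFrobeniusBlock
  let w : Basis (Fin r) F W := u.dualBasis.map γ.flip.toPerfPair.symm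
  have hγ : ∀ i j, γ (u i) (w j) = (1 : Matrix (Fin r) (Fin r) F) i j := fun i j => by
    simp [w, one_apply, Finsupp.single_apply]
  have hα : ∀ i j, α (u j) (w i) = Φ i j := fun i j => by
    simp [hu, hγ, one_apply]
  refine ⟨r + r, ((u.prod w).map E).reindex finSumFinEquiv, Or.inl ⟨r, rfl, Φ, hΦ, ?_, ?_⟩⟩
  · rintro ⟨Q, hQ, rfl⟩
    let T : U ≃ₗ[F] W := LinearEquiv.ofLinearMap (toLin u w Q) (toLin w u Q⁻¹)
      (by rw [← toLin_mul, mul_nonsing_inv _ ((isUnit_iff_isUnit_det _).1 hQ), toLin_one])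
      (by rw [← toLin_mul, nonsing_inv_mul _ ((isUnit_iff_isUnit_det _).1 hQ), toLin_one])
    refine hB.not_symmetric h2 h T fun x y => ?_
    suffices α.flip ∘ₗ T.toLinearMap = (γ.compl₂ T.toLinearMap) from
      LinearMap.congr_fun (LinearMap.congr_fun this x) y
    have hT : ∀ i, T (u i) = ∑ k, Q k i • w k := fun i => toLin_self u w Q i
    have hQ' : Qᵀ * (Q⁻¹ᵀ * Q) = Q := by
      rw [← mul_assoc, ← transpose_mul, nonsing_inv_mul _ ((isUnit_iff_isUnit_det _).1 hQ),
        transpose_one, one_mul]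
    refine u.ext fun i => u.ext fun j => ?_
    calc α (u j) (T (u i)) = (Qᵀ * (Q⁻¹ᵀ * Q)) i j := by
          simp [hT, hα, mul_apply (M := Qᵀ)]
      _ = γ (u i) (T (u j)) := by simp [hQ', hT, hγ, one_apply]
  · ext i j
    obtain ⟨i, rfl⟩ := finSumFinEquiv.surjective i
    obtain ⟨j, rfl⟩ := finSumFinEquiv.surjective j
    rw [LinearMap.toMatrix₂_apply]
    rcases i with i | i <;> rcases j with j | j <;>
      simp [skewSum, h _ _ _ _, hγ, hα, -finSumFinEquiv_apply_left, -finSumFinEquiv_apply_right]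

theorem IsHyperbolicPencil.hasBlockBasis_of_isSingularPencil {B : V →ₗ[F] V →ₗ[F] F}
    {E : (U × W) ≃ₗ[F] V} {α γ : U →ₗ[F] W →ₗ[F] F} (h : IsHyperbolicPencil B E α γ)
    (hs : IsSingularPencil α γ) : HasBlockBasis B := by
  obtain ⟨m, u, w, hα, hγ⟩ := hs
  let f : Fin (m + 1) ⊕ Fin m → Fin (2 * m + 1) :=
    Sum.elim (fun i => ⟨2 * m - 2 * i, by omega⟩) fun j => ⟨2 * m - 1 - 2 * j, by omega⟩
  have hf : Function.Bijective f := by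
    rw [Fintype.bijective_iff_injective_and_card]
    refine ⟨?_, by simp; omega⟩
    rintro (i | i) (j | j) hij <;> simp [f, Fin.ext_iff] at hij ⊢ <;> omega
  refine ⟨2 * m + 1, ((u.prod w).map E).reindex (Equiv.ofBijective f hf),
    Or.inr (Or.inr ⟨⟨m, rfl⟩, ?_⟩)⟩
  ext i j
  obtain ⟨i, rfl⟩ := (Equiv.ofBijective f hf).surjective i
  obtain ⟨j, rfl⟩ := (Equiv.ofBijective f hf).surjective j
  rw [LinearMap.toMatrix₂_apply]
  simp only [Basis.reindex_apply, Equiv.symm_apply_apply, Basis.map_apply]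
  rcases i with i | i <;> rcases j with j | j <;>
    simp [jordanBlock, f, h _ _ _ _, hα, hγ] <;> first | omega | (split_ifs <;> first | rfl | omega)

end Forms

section Decomposition

open Module

variable {V : Type*} [AddCommGroup V] [Module F V]

/-- The adjunction involution on the pairs of endomorphisms adjoint with respect to both a form
and its transpose. -/
instance pencilStarRing (B : V →ₗ[F] V →ₗ[F] F) : StarRing (pencilAlg B B.flip) where
  star x := ⟨(x.1.2.unop, MulOpposite.op x.1.1),
    fun u w => (x.2.2 w u).symm, fun u w => (x.2.1 w u).symm⟩
  star_involutive _ := rfl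
  star_mul _ _ := rfl
  star_add _ _ := rfl

/-- An indecomposable form that is decomposable as a pencil is hyperbolic. -/
theorem FormIndec.exists_hyperbolic [FiniteDimensional F V] (h2 : (2 : F) ≠ 0)
    {B : V →ₗ[F] V →ₗ[F] F} (hB : FormIndec B) (h : ¬ PencilIndec B B.flip) :
    ∃ S : End F V, S * S = S ∧ ∀ x y, B (S x) y = B x ((1 - S) y) := by
  have : FiniteDimensional F (End F V)ᵐᵒᵖ :=
    Module.Finite.equiv (MulOpposite.opLinearEquiv F)
  simp only [PencilIndec, not_forall, not_or] at h
  obtain ⟨P, Q, hPQ, hP, hQ, h0, h1⟩ := h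
  obtain ⟨f, hf, hf1⟩ := exists_hyperbolic_idempotent (F := F) (T := pencilAlg B B.flip)
    (fun _ _ => rfl) h2 (fun e he hes => by
      have h12 : e.1.1 = e.1.2.unop := congrArg (fun x => x.1.2.unop) hes
      have hS := hB e.1.1 (fun x y => by
        have := e.2.1 x y
        rwa [← h12] at this) (congrArg (fun x => x.1.1) he)
      refine hS.imp (fun hS => ?_) fun hS => ?_
      · exact Subtype.ext (Prod.ext hS (MulOpposite.unop_injective (h12.symm.trans hS)))
      · exact Subtype.ext (Prod.ext hS (MulOpposite.unop_injective (h12.symm.trans hS))))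
    ⟨(P, MulOpposite.op Q), hPQ⟩
    (Subtype.ext (Prod.ext hP (MulOpposite.unop_injective hQ)))
    (fun h => h0 ⟨congrArg (fun x => x.1.1) h, congrArg (fun x => x.1.2.unop) h⟩)
    (fun h => h1 ⟨congrArg (fun x => x.1.1) h, congrArg (fun x => x.1.2.unop) h⟩)
  refine ⟨f.1.1, congrArg (fun x => x.1.1) hf, fun x y => ?_⟩
  have : f.1.1 + f.1.2.unop = 1 := congrArg (fun x => x.1.1) hf1
  rw [← this, add_sub_cancel_left]
  exact f.2.1 x y

variable {U W : Type*} [AddCommGroup U] [Module F U] [AddCommGroup W] [Module F W]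

theorem FormIndec.hasBlockBasis_of_injective [FiniteDimensional F U] [FiniteDimensional F W]
    [Nontrivial V] (h2 : (2 : F) ≠ 0) {B : V →ₗ[F] V →ₗ[F] F} (hB : FormIndec B)
    {E : (U × W) ≃ₗ[F] V} {α γ : U →ₗ[F] W →ₗ[F] F} (h : IsHyperbolicPencil B E α γ)
    (hγ : Function.Injective γ) (hγ' : Function.Injective γ.flip) : HasBlockBasis B := by
  have := LinearMap.IsPerfPair.of_injective hγ hγ'
  rcases subsingleton_or_nontrivial U with hU | hU
  · have hW : Subsingleton W := ⟨fun x y => hγ' (LinearMap.ext fun u => by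
      rw [Subsingleton.elim u 0, map_zero, map_zero])⟩
    exact (not_subsingleton V E.symm.injective.subsingleton).elim
  · exact hB.hasBlockBasis_of_isPerfPair h2 h

theorem FormIndec.hasBlockBasis_of_isHyperbolicPencil [FiniteDimensional F U]
    [FiniteDimensional F W] [Nontrivial V] (h2 : (2 : F) ≠ 0) {B : V →ₗ[F] V →ₗ[F] F}
    (hB : FormIndec B) {E : (U × W) ≃ₗ[F] V} {α γ : U →ₗ[F] W →ₗ[F] F}
    (h : IsHyperbolicPencil B E α γ) : HasBlockBasis B := by
  have hp := hB.pencilIndec h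
  by_cases hγ : Function.Injective γ
  · by_cases hγ' : Function.Injective γ.flip
    · exact hB.hasBlockBasis_of_injective h2 h hγ hγ'
    · simp only [injective_iff_map_eq_zero, not_forall] at hγ'
      obtain ⟨v, hγv, hv⟩ := hγ'
      rcases hp.flip.singular_or_nondegenerate hv hγv with hs | ⟨hα, hα'⟩
      · exact h.swap.hasBlockBasis_of_isSingularPencil hs
      · exact hB.hasBlockBasis_of_injective h2 h.swap hα hα'
  · simp only [injective_iff_map_eq_zero, not_forall] at hγ
    obtain ⟨v, hγv, hv⟩ := hγ
    rcases hp.symm.singular_or_nondegenerate hv hγv with hs | ⟨hα, hα'⟩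
    · exact h.hasBlockBasis_of_isSingularPencil hs.symm
    · exact hB.hasBlockBasis_of_injective h2 h.swap hα' hα

/-- An indecomposable form has a canonical block as its matrix in some basis. -/
theorem FormIndec.hasBlockBasis [FiniteDimensional F V] [Nontrivial V] (h2 : (2 : F) ≠ 0)
    {B : V →ₗ[F] V →ₗ[F] F} (hB : FormIndec B) : HasBlockBasis B := by
  by_cases h : PencilIndec B B.flip
  · exact h.hasBlockBasis
  · obtain ⟨S, hS2, hS⟩ := hB.exists_hyperbolic h2 h
    have hc := LinearMap.IsIdempotentElem.isCompl (f := S) hS2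
    have hrange : ∀ x ∈ S.range, (1 - S) x = 0 := by
      rintro _ ⟨x, rfl⟩
      rw [LinearMap.sub_apply, ← Module.End.mul_apply S S, hS2, Module.End.one_apply, sub_self]
    have hker : ∀ x ∈ S.ker, (1 - S) x = x := fun x hx => by
      rw [LinearMap.sub_apply, LinearMap.mem_ker.1 hx, sub_zero, Module.End.one_apply]
    have hrange' : ∀ x ∈ S.range, S x = x := fun x hx => (sub_eq_zero.1 (hrange x hx)).symm
    refine hB.hasBlockBasis_of_isHyperbolicPencil h2 (E := Submodule.prodEquivOfIsCompl _ _ hc)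
      (α := B.flip.domRestrict₁₂ _ _) (γ := B.domRestrict₁₂ _ _) fun u w u' w' => ?_
    have h1 : B u u' = 0 := by
      rw [← hrange' u u.2, hS, hrange _ u'.2, map_zero]
    have h3 : B w w' = 0 := by
      rw [← hker w' w'.2, ← hS, LinearMap.mem_ker.1 w.2, map_zero, LinearMap.zero_apply]
    simp [h1, h3, LinearMap.domRestrict₁₂_apply]

/-- The form `B` is an orthogonal direct sum of forms given by canonical blocks. -/
def HasBlockDecomposition (B : V →ₗ[F] V →ₗ[F] F) : Prop :=
  ∃ (ι : Type) (_ : Fintype ι) (_ : DecidableEq ι) (d : ι → ℕ)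
    (blocks : ∀ i, Matrix (Fin (d i)) (Fin (d i)) F) (b : Basis (Σ i, Fin (d i)) F V),
    (∀ i, GoodBlock13 (blocks i)) ∧ LinearMap.toMatrix₂ b b B = blockDiagonal' blocks

theorem HasBlockDecomposition.prod {B : V →ₗ[F] V →ₗ[F] F} {B₁ : U →ₗ[F] U →ₗ[F] F}
    {B₂ : W →ₗ[F] W →ₗ[F] F} (h₁ : HasBlockDecomposition B₁) (h₂ : HasBlockDecomposition B₂)
    (E : (U × W) ≃ₗ[F] V)
    (hE : ∀ u w u' w', B (E (u, w)) (E (u', w')) = B₁ u u' + B₂ w w') :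
    HasBlockDecomposition B := by
  obtain ⟨ι₁, _, _, d₁, A₁, b₁, hA₁, hb₁⟩ := h₁
  obtain ⟨ι₂, _, _, d₂, A₂, b₂, hA₂, hb₂⟩ := h₂
  simp only [← Matrix.ext_iff, LinearMap.toMatrix₂_apply] at hb₁ hb₂
  let e := Equiv.sumSigmaDistrib fun i => Fin (Sum.elim d₁ d₂ i)
  let b := ((b₁.prod b₂).map E).reindex e.symm
  have hl : ∀ i x, b ⟨.inl i, x⟩ = E (b₁ ⟨i, x⟩, 0) := fun i x => by
    refine (Basis.reindex_apply _ _ _).trans ?_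
    change E (b₁.prod b₂ (.inl ⟨i, x⟩)) = _
    simp [Basis.prod_apply]
  have hr : ∀ i x, b ⟨.inr i, x⟩ = E (0, b₂ ⟨i, x⟩) := fun i x => by
    refine (Basis.reindex_apply _ _ _).trans ?_
    change E (b₁.prod b₂ (.inr ⟨i, x⟩)) = _
    simp [Basis.prod_apply]
  refine ⟨ι₁ ⊕ ι₂, inferInstance, inferInstance, Sum.elim d₁ d₂, Sum.rec A₁ A₂, b,
    Sum.rec hA₁ hA₂, ?_⟩
  ext ⟨i | i, x⟩ ⟨j | j, y⟩
  · by_cases hij : i = j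
    · subst hij
      simp [LinearMap.toMatrix₂_apply, hl, hE, hb₁]
      exact blockDiagonal'_apply_eq A₁ i x y
    · simp [LinearMap.toMatrix₂_apply, hl, hE, hb₁,
        blockDiagonal'_apply_ne _ _ _ (Sum.inl_injective.ne hij)]
      exact blockDiagonal'_apply_ne A₁ x y hij
  · simp [LinearMap.toMatrix₂_apply, hl, hr, hE, blockDiagonal'_apply_ne]
  · simp [LinearMap.toMatrix₂_apply, hl, hr, hE, blockDiagonal'_apply_ne]
  · by_cases hij : i = j
    · subst hij
      simp [LinearMap.toMatrix₂_apply, hr, hE, hb₂]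
      exact blockDiagonal'_apply_eq A₂ i x y
    · simp [LinearMap.toMatrix₂_apply, hr, hE, hb₂,
        blockDiagonal'_apply_ne _ _ _ (Sum.inr_injective.ne hij)]
      exact blockDiagonal'_apply_ne A₂ x y hij

theorem hasBlockDecomposition (h2 : (2 : F) ≠ 0) (n : ℕ) : ∀ (V : Type*) [AddCommGroup V]
    [Module F V] [FiniteDimensional F V] (B : V →ₗ[F] V →ₗ[F] F), finrank F V = n →
    HasBlockDecomposition B := by
  induction n using Nat.strong_induction_on with
  | _ n ih =>
  rintro V _ _ _ B rfl
  by_cases hB : FormIndec B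
  · rcases subsingleton_or_nontrivial V with hV | hV
    · exact ⟨Empty, inferInstance, inferInstance, fun _ => 0, fun i => i.elim, Basis.empty V,
        fun i => i.elim, by ext ⟨i, _⟩; exact i.elim⟩
    · obtain ⟨m, b, hb⟩ := hB.hasBlockBasis h2
      refine ⟨Unit, inferInstance, inferInstance, fun _ => m, fun _ => LinearMap.toMatrix₂ b b B,
        b.reindex (Equiv.uniqueSigma fun _ => Fin m).symm, fun _ => hb, ?_⟩
      ext ⟨i, x⟩ ⟨j, y⟩
      simp [LinearMap.toMatrix₂_apply]
      rfl
  · simp only [FormIndec, not_forall, not_or] at hB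
    obtain ⟨S, hS, hS2, h0, h1⟩ := hB
    have hc := LinearMap.IsIdempotentElem.isCompl (f := S) hS2
    have hrange : ∀ x ∈ S.range, S x = x := by
      rintro _ ⟨x, rfl⟩
      rw [← Module.End.mul_apply S S, hS2]
    have hlt : finrank F S.range < finrank F V := Submodule.finrank_lt fun h => h1 <| by
      ext x
      exact hrange x (h ▸ Submodule.mem_top)
    have hlt' : finrank F S.ker < finrank F V := Submodule.finrank_lt fun h =>
      h0 (LinearMap.ker_eq_top.1 h)
    refine (ih _ hlt S.range (B.domRestrict₁₂ _ _) rfl).prod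
      (ih _ hlt' S.ker (B.domRestrict₁₂ _ _) rfl) (Submodule.prodEquivOfIsCompl _ _ hc)
      fun u w u' w' => ?_
    have h3 : B u w' = 0 := by
      rw [← hrange u u.2, hS, LinearMap.mem_ker.1 w'.2, map_zero]
    have h4 : B w u' = 0 := by
      rw [← hrange u' u'.2, ← hS, LinearMap.mem_ker.1 w.2, map_zero, LinearMap.zero_apply]
    simp [h3, h4, LinearMap.domRestrict₁₂_apply]

end Decomposition


/-- every square matrix over a field of characteristic not 2 is congruent
to a block-diagonal direct sum of matrices of the three canonical forms. -/
theorem stmt_13 {F : Type*} [Field F] (hchar : (2 : F) ≠ 0) {n : ℕ}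
    (M : Matrix (Fin n) (Fin n) F) :
    ∃ (k : ℕ) (d : Fin k → ℕ) (blocks : ∀ i : Fin k, Matrix (Fin (d i)) (Fin (d i)) F),
      (∀ i : Fin k, GoodBlock13 (blocks i)) ∧
      ∃ e : Fin n ≃ (Σ i : Fin k, Fin (d i)),
        MatCongruent M (Matrix.reindex e.symm e.symm (Matrix.blockDiagonal' blocks)) := by
  obtain ⟨ι, _, _, d, A, b, hA, hb⟩ := hasBlockDecomposition hchar _ (Fin n → F)
    (Matrix.toLinearMap₂' F M) rfl
  let k := Fintype.equivFin ι
  let t : (Σ i, Fin (d (k.symm i))) ≃ Σ i, Fin (d i) :=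
    Equiv.sigmaCongrLeft (β := fun i => Fin (d i)) k.symm
  let c := b.reindex t.symm
  let e := (Pi.basisFun F (Fin n)).indexEquiv c
  refine ⟨Fintype.card ι, fun i => d (k.symm i), fun i => A (k.symm i), fun i => hA _, e,
    (Pi.basisFun F (Fin n)).toMatrix (c.reindex e.symm), ?_, ?_⟩
  · have := (Pi.basisFun F (Fin n)).invertibleToMatrix (c.reindex e.symm)
    exact isUnit_of_invertible _
  · have hM : LinearMap.toMatrix₂ (Pi.basisFun F (Fin n)) (Pi.basisFun F (Fin n))
        (Matrix.toLinearMap₂' F M) = M := by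
      rw [LinearMap.toMatrix₂_basisFun]
      exact LinearMap.toMatrix'_toLinearMap₂' M
    conv_lhs => rw [← hM]
    rw [LinearMap.toMatrix₂_mul_basis_toMatrix]
    ext i j
    obtain ⟨⟨i, x⟩, rfl⟩ := e.symm.surjective i
    obtain ⟨⟨j, y⟩, rfl⟩ := e.symm.surjective j
    have := congrFun (congrFun hb ⟨k.symm i, x⟩) ⟨k.symm j, y⟩
    rw [LinearMap.toMatrix₂_apply] at this ⊢
    have hc : ∀ i x, c.reindex e.symm (e.symm ⟨i, x⟩) = b ⟨k.symm i, x⟩ := fun i x => by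
      rw [Module.Basis.reindex_apply, Equiv.symm_symm, Equiv.apply_symm_apply,
        Module.Basis.reindex_apply]
      rfl
    rw [hc, hc, this, Matrix.reindex_apply, Matrix.submatrix_apply, Equiv.symm_symm,
      Equiv.apply_symm_apply, Equiv.apply_symm_apply]
    by_cases hij : i = j
    · subst hij
      rw [blockDiagonal'_apply_eq, blockDiagonal'_apply_eq]
    · rw [blockDiagonal'_apply_ne _ _ _ hij,
        blockDiagonal'_apply_ne _ _ _ (k.symm.injective.ne hij)]
end
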